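/- Let u be a solution of the variational problem: u minimizes J(w) := ∫_D|∇w|² − λ_a∫_D w² among all w ∈ H¹₀(D) with |Ω_w| ≤ a. If ω is an open subset of D with |Ω_u ∩ ω| = |ω|, then −Δu = λ_a u in ω (in the sense of distributions), and consequently ω ⊂ Ω_u (u > 0 everywhere in ω). -/

import Mathlib

open MeasureTheory Filter Metric Set
open scoped RealInnerProductSpace ENNReal Topology NNReal

noncomputable section

abbrev Euc (d : ℕ) := EuclideanSpace ℝ (Fin d)

variable {d : ℕ}

/-- Real-valued Lebesgue volume of a set. -/
def mvol (s : Set (Euc d)) : ℝ := (volume s).toReal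

/-- Smooth scalar test function compactly supported in `Ω`. -/
def TestFun (Ω : Set (Euc d)) (φ : Euc d → ℝ) : Prop :=
  ContDiff ℝ (⊤ : ℕ∞) φ ∧ HasCompactSupport φ ∧ tsupport φ ⊆ Ω

/-- Smooth vector field compactly supported in `Ω`. -/
def VecTestFun (Ω : Set (Euc d)) (Φ : Euc d → Euc d) : Prop :=
  ContDiff ℝ (⊤ : ℕ∞) Φ ∧ HasCompactSupport Φ ∧ tsupport Φ ⊆ Ω

/-- Membership in `H¹₀(Ω)`, encoded through `L²` integrability of the function and of its
(a.e. defined) gradient, together with approximation in the `H¹` norm by smooth functions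
compactly supported in `Ω`. -/
def MemH10 (Ω : Set (Euc d)) (v : Euc d → ℝ) : Prop :=
  MemLp v 2 (volume : Measure (Euc d)) ∧
  MemLp (fun x => gradient v x) 2 (volume : Measure (Euc d)) ∧
  ∃ φ : ℕ → Euc d → ℝ, (∀ n, TestFun Ω (φ n)) ∧
    Tendsto (fun n => ∫ x, ((v x - φ n x) ^ 2 + ‖gradient v x - gradient (φ n) x‖ ^ 2))
      atTop (nhds 0)

/-- First Dirichlet eigenvalue of `Ω`, via the Rayleigh quotient variational characterization. -/
def lam1 (Ω : Set (Euc d)) : ℝ :=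
  sInf {t : ℝ | ∃ v : Euc d → ℝ, MemH10 Ω v ∧ (∫ x, (v x) ^ 2) = 1 ∧
    t = ∫ x, ‖gradient v x‖ ^ 2}

/-- `u` is a normalized first Dirichlet eigenfunction of `Ω`. -/
def IsFirstEigenfun (Ω : Set (Euc d)) (u : Euc d → ℝ) : Prop :=
  MemH10 Ω u ∧ (∫ x, (u x) ^ 2) = 1 ∧ (∫ x, ‖gradient u x‖ ^ 2) = lam1 Ω ∧
  ∀ φ : Euc d → ℝ, TestFun Ω φ →
    (∫ x, ⟪gradient u x, gradient φ x⟫) = lam1 Ω * ∫ x, u x * φ x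

/-- `Ω` solves the shape optimization problem: it minimizes `λ₁` among open subsets of `D` of
measure `a`. -/
structure IsOptimalShape (D : Set (Euc d)) (a : ℝ) (Ω : Set (Euc d)) : Prop where
  isOpen : IsOpen Ω
  subset : Ω ⊆ D
  meas : mvol Ω = a
  minim : ∀ Ω' : Set (Euc d), IsOpen Ω' → Ω' ⊆ D → mvol Ω' = a → lam1 Ω ≤ lam1 Ω'

/-- `u` is locally Lipschitz continuous in `s`. -/
def LocLipOn (s : Set (Euc d)) (u : Euc d → ℝ) : Prop :=
  ∀ x ∈ s, ∃ t, t ∈ 𝓝 x ∧ t ⊆ s ∧ ∃ K : ℝ≥0, LipschitzOnWith K u t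

/-- Divergence of a vector field. -/
def divg (Φ : Euc d → Euc d) (x : Euc d) : ℝ :=
  ∑ i, fderiv ℝ Φ x (EuclideanSpace.single i 1) i

/-- `Ω` has locally finite perimeter in `D` (its characteristic function has locally bounded
variation in `D`). -/
def HasLocFinPerimeterIn (D Ω : Set (Euc d)) : Prop :=
  ∀ K : Set (Euc d), IsCompact K → K ⊆ D → ∃ C : ℝ,
    ∀ Φ : Euc d → Euc d, VecTestFun K Φ → (∀ x, ‖Φ x‖ ≤ 1) →
      (∫ x in Ω, divg Φ x) ≤ C

/-- The reduced boundary of `Ω`: points where `Ω` blows up to a half space, in the sense that the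
symmetric difference with a half space is of vanishing density. -/
def reducedBoundary (Ω : Set (Euc d)) : Set (Euc d) :=
  {x | ∃ ν : Euc d, ‖ν‖ = 1 ∧
    Tendsto (fun r : ℝ =>
        volume (symmDiff (Ω ∩ ball x r) ({y | ⟪y - x, ν⟫ ≤ 0} ∩ ball x r)) /
          ENNReal.ofReal (r ^ d))
      (𝓝[>] 0) (𝓝 0)}

/-- `S` is an analytic hypersurface in `D`: near each of its points in `D` it is the zero set of
an analytic function with nonvanishing gradient. -/
def IsAnalyticHypersurfaceIn (D S : Set (Euc d)) : Prop :=
  ∀ x ∈ S ∩ D, ∃ U : Set (Euc d), IsOpen U ∧ x ∈ U ∧ U ⊆ D ∧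
    ∃ f : Euc d → ℝ, AnalyticOn ℝ f U ∧ (∀ y ∈ U, fderiv ℝ f y ≠ 0) ∧
      S ∩ U = {y ∈ U | f y = 0}

/-- The functional `J(v) = ∫ |∇v|² - λ ∫ v²`. -/
def Jfun (lam : ℝ) (v : Euc d → ℝ) : ℝ :=
  (∫ x, ‖gradient v x‖ ^ 2) - lam * ∫ x, (v x) ^ 2

/-- `Ω_v = {x ∈ D : v(x) ≠ 0}`. -/
def Om (D : Set (Euc d)) (v : Euc d → ℝ) : Set (Euc d) := {x ∈ D | v x ≠ 0}

/-- The optimal value `λ_a` of `λ₁` among open subsets of `D` of measure `a`. -/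
def lamOpt (D : Set (Euc d)) (a : ℝ) : ℝ :=
  sInf {t : ℝ | ∃ Ω : Set (Euc d), IsOpen Ω ∧ Ω ⊆ D ∧ mvol Ω = a ∧ t = lam1 Ω}

/-- `u` minimizes `J` among functions of `H¹₀(D)` with `|Ω_w| ≤ a`. -/
def IsJMinimizer (D : Set (Euc d)) (a lam : ℝ) (u : Euc d → ℝ) : Prop :=
  MemH10 D u ∧ mvol (Om D u) ≤ a ∧
  ∀ w : Euc d → ℝ, MemH10 D w → mvol (Om D w) ≤ a → Jfun lam u ≤ Jfun lam w

/-- The class `F` of perturbations of `u` supported in `B`. -/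
def Fcal (D B : Set (Euc d)) (u v : Euc d → ℝ) : Prop :=
  MemH10 D v ∧ MemH10 B (fun x => u x - v x)

/-- The set of penalization constants `μ₋` admissible for `h` (inward perturbations). -/
def Mminus (D : Set (Euc d)) (a lam : ℝ) (u : Euc d → ℝ) (B : Set (Euc d)) (h : ℝ) :
    Set ℝ :=
  {μ : ℝ | 0 ≤ μ ∧ ∀ v : Euc d → ℝ, Fcal D B u v →
    a - h ≤ mvol (Om D v) → mvol (Om D v) ≤ a →
    Jfun lam u + μ * mvol (Om D u) ≤ Jfun lam v + μ * mvol (Om D v)}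

/-- The set of penalization constants `μ₊` admissible for `h` (outward perturbations). -/
def Mplus (D : Set (Euc d)) (a lam : ℝ) (u : Euc d → ℝ) (B : Set (Euc d)) (h : ℝ) :
    Set ℝ :=
  {μ : ℝ | 0 ≤ μ ∧ ∀ v : Euc d → ℝ, Fcal D B u v →
    a ≤ mvol (Om D v) → mvol (Om D v) ≤ a + h →
    Jfun lam u + μ * mvol (Om D u) ≤ Jfun lam v + μ * mvol (Om D v)}

/-- `μ₋(h)`: the biggest admissible inward penalization constant. -/
def muMinus (D : Set (Euc d)) (a lam : ℝ) (u : Euc d → ℝ) (B : Set (Euc d)) (h : ℝ) : ℝ :=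
  sSup (Mminus D a lam u B h)

/-- `μ₊(h)`: the smallest admissible outward penalization constant. -/
def muPlus (D : Set (Euc d)) (a lam : ℝ) (u : Euc d → ℝ) (B : Set (Euc d)) (h : ℝ) : ℝ :=
  sInf (Mplus D a lam u B h)

/-- Average of `u` on the sphere `∂B(x,r)`, with respect to the `(d-1)`-Hausdorff measure. -/
def sphAvg (u : Euc d → ℝ) (x : Euc d) (r : ℝ) : ℝ :=
  (∫ y in sphere x r, u y ∂(μH[(d : ℝ) - 1])) / ((μH[(d : ℝ) - 1]) (sphere x r)).toReal

open scoped Convolution in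
/-- Mollification. -/
def Mol {E' : Type*} [NormedAddCommGroup E'] [NormedSpace ℝ E']
    (b : ContDiffBump (0 : Euc d)) (F : Euc d → E') : Euc d → E' :=
  (b.normed volume) ⋆[ContinuousLinearMap.lsmul ℝ ℝ, volume] F

lemma Mol_apply {E' : Type*} [NormedAddCommGroup E'] [NormedSpace ℝ E']
    (b : ContDiffBump (0 : Euc d)) (F : Euc d → E') (x : Euc d) :
    Mol b F x = ∫ t, b.normed volume t • F (x - t) := rfl

lemma Mol_eLpNorm_le {E' : Type*} [NormedAddCommGroup E'] [NormedSpace ℝ E']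
    (b : ContDiffBump (0 : Euc d)) (F : Euc d → E') (hF : Continuous F) :
    eLpNorm (Mol b F) 2 volume ≤ eLpNorm F 2 volume := by
  have h2 : ∀ G : Euc d → E', eLpNorm G 2 volume = (∫⁻ x, ‖G x‖ₑ ^ (2:ℝ)) ^ (1/2:ℝ) := by
    intro G
    rw [eLpNorm_eq_lintegral_rpow_enorm_toReal (by simp) (by simp)]
    simp
  rw [h2, h2]
  gcongr ?_ ^ (1/2:ℝ)
  set ρ : Euc d → ℝ≥0∞ := fun t => ‖b.normed volume t‖ₑ with hρ
  have hρm : Measurable ρ := (b.continuous_normed.measurable.enorm)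
  have hρ1 : ∫⁻ t, ρ t = 1 := by
    have := b.integral_normed (μ := (volume : Measure (Euc d)))
    rw [hρ]
    have h3 : ∀ t, ‖b.normed volume t‖ₑ = ENNReal.ofReal (b.normed volume t) := fun t =>
      Real.enorm_of_nonneg (b.nonneg_normed t)
    simp_rw [h3]
    rw [← ofReal_integral_eq_lintegral_ofReal b.integrable_normed (ae_of_all _ b.nonneg_normed),
      this]
    simp
  set ν : Measure (Euc d) := volume.withDensity ρ with hν
  have hν1 : ν univ = 1 := by simp [hν, hρ1]
  have : IsProbabilityMeasure ν := ⟨hν1⟩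
  have key : ∀ x, ‖Mol b F x‖ₑ ^ (2:ℝ) ≤ ∫⁻ t, ‖F (x - t)‖ₑ ^ (2:ℝ) ∂ν := by
    intro x
    have hm : Measurable fun t => ‖F (x - t)‖ₑ := by
      have : Continuous fun t => F (x - t) := by fun_prop
      exact this.enorm.measurable
    have e1 : ‖Mol b F x‖ₑ ≤ ∫⁻ t, ‖F (x - t)‖ₑ ∂ν := by
      rw [Mol_apply]
      refine (enorm_integral_le_lintegral_enorm _).trans ?_
      rw [hν, lintegral_withDensity_eq_lintegral_mul _ hρm hm]
      simp [enorm_smul, hρ]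
    have e2 := ENNReal.lintegral_mul_le_Lp_mul_Lq ν (p := 2) (q := 2)
      (by constructor <;> norm_num) (f := fun _ => 1) (g := fun t => ‖F (x - t)‖ₑ)
      aemeasurable_const hm.aemeasurable
    simp only [Pi.mul_apply, one_mul, ENNReal.one_rpow, lintegral_const, hν1] at e2
    calc ‖Mol b F x‖ₑ ^ (2:ℝ) ≤ ((∫⁻ t, ‖F (x - t)‖ₑ ^ (2:ℝ) ∂ν) ^ (1/2:ℝ)) ^ (2:ℝ) := by
          gcongr
          simpa using e1.trans (by simpa using e2)
      _ = _ := by rw [← ENNReal.rpow_mul]; norm_num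
  calc ∫⁻ x, ‖Mol b F x‖ₑ ^ (2:ℝ) ≤ ∫⁻ x, ∫⁻ t, ‖F (x - t)‖ₑ ^ (2:ℝ) ∂ν := lintegral_mono key
    _ = ∫⁻ t, ∫⁻ x, ‖F (x - t)‖ₑ ^ (2:ℝ) ∂volume ∂ν := by
        apply lintegral_lintegral_swap
        apply Measurable.aemeasurable
        have : Continuous fun p : Euc d × Euc d => F (p.1 - p.2) := by fun_prop
        exact (this.enorm.measurable.pow_const _)
    _ = ∫⁻ t, ∫⁻ x, ‖F x‖ₑ ^ (2:ℝ) ∂volume ∂ν := by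
        congr 1; ext t
        exact lintegral_sub_right_eq_self (fun x => ‖F x‖ₑ ^ (2:ℝ)) t
    _ = _ := by simp [hν1]

lemma TestFun.cg {Ω : Set (Euc d)} {φ : Euc d → ℝ} (h : TestFun Ω φ) :
    Continuous (gradient φ) := by
  have : Continuous (fderiv ℝ φ) := h.1.continuous_fderiv (by simp)
  exact (InnerProductSpace.toDual ℝ (Euc d)).symm.continuous.comp this

lemma TestFun.sg {Ω : Set (Euc d)} {φ : Euc d → ℝ} (h : TestFun Ω φ) :
    HasCompactSupport (gradient φ) := by
  have := h.2.1.fderiv ℝ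
  exact this.comp_left (g := (InnerProductSpace.toDual ℝ (Euc d)).symm) (by simp)

lemma TestFun.diff {Ω : Set (Euc d)} {φ : Euc d → ℝ} (h : TestFun Ω φ) :
    Differentiable ℝ φ := h.1.differentiable (by simp)

lemma TestFun.lp {Ω : Set (Euc d)} {φ : Euc d → ℝ} (h : TestFun Ω φ) :
    MemLp φ 2 volume := h.1.continuous.memLp_of_hasCompactSupport h.2.1

lemma TestFun.glp {Ω : Set (Euc d)} {φ : Euc d → ℝ} (h : TestFun Ω φ) :
    MemLp (gradient φ) 2 volume := h.cg.memLp_of_hasCompactSupport h.sg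

lemma Mol_contDiff {Ω : Set (Euc d)} {φ : Euc d → ℝ} (h : TestFun Ω φ)
    (b : ContDiffBump (0 : Euc d)) : ContDiff ℝ (⊤ : ℕ∞) (Mol b φ) :=
  h.2.1.contDiff_convolution_right _ b.continuous_normed.locallyIntegrable h.1

lemma Mol_grad {Ω : Set (Euc d)} {φ : Euc d → ℝ} (h : TestFun Ω φ)
    (b : ContDiffBump (0 : Euc d)) : gradient (Mol b φ) = Mol b (gradient φ) := by
  refine gradient_eq fun x => ?_
  rw [hasGradientAt_iff_hasFDerivAt]
  refine HasFDerivAt.congr_fderiv (h.2.1.hasFDerivAt_convolution_right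
    (ContinuousLinearMap.lsmul ℝ ℝ)
    (b.continuous_normed.locallyIntegrable (μ := volume)) (h.1.of_le (by simp)) x) ?_
  symm
  rw [Mol_apply]
  change (InnerProductSpace.toDual ℝ (Euc d)).toContinuousLinearEquiv.toContinuousLinearMap _ = _
  rw [← ContinuousLinearMap.integral_comp_comm]
  · rw [convolution]
    congr 1; ext t v
    simp [ContinuousLinearMap.precompR]
  · apply Continuous.integrable_of_hasCompactSupport
    · have := h.cg
      have := b.continuous_normed (μ := (volume : Measure (Euc d)))
      fun_prop
    · exact b.hasCompactSupport_normed.smul_right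

lemma Mol_sub {E' : Type*} [NormedAddCommGroup E'] [NormedSpace ℝ E']
    (b : ContDiffBump (0 : Euc d)) (F G : Euc d → E') (hF : Continuous F) (hG : Continuous G) :
    Mol b (F - G) = Mol b F - Mol b G := by
  ext x
  simp only [Pi.sub_apply, Mol_apply, smul_sub]
  have hb := b.continuous_normed (μ := (volume : Measure (Euc d)))
  apply integral_sub
  · exact Continuous.integrable_of_hasCompactSupport (by fun_prop)
      (b.hasCompactSupport_normed.smul_right)
  · exact Continuous.integrable_of_hasCompactSupport (by fun_prop)
      (b.hasCompactSupport_normed.smul_right)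


lemma Mol_tendsto {E' : Type*} [NormedAddCommGroup E'] [NormedSpace ℝ E'] [CompleteSpace E']
    (F : Euc d → E') (hF : Continuous F) (hs : HasCompactSupport F) {η : ℝ} (hη : 0 < η) :
    ∃ r₀ > 0, ∀ b : ContDiffBump (0 : Euc d), b.rOut ≤ r₀ →
      eLpNorm (Mol b F - F) 2 volume ≤ ENNReal.ofReal η := by
  set K := cthickening 1 (tsupport F) with hK
  have hKc : IsCompact K := hs.isCompact.cthickening
  have hV : volume K < ∞ := hKc.measure_lt_top
  obtain ⟨ε, hε, hεη⟩ : ∃ ε > 0, ENNReal.ofReal ε * (volume K) ^ (1/2:ℝ) ≤ ENNReal.ofReal η := by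
    set V := ((volume K) ^ (1/2:ℝ)).toReal with hVd
    have hVt : (volume K) ^ (1/2:ℝ) = ENNReal.ofReal V := by
      rw [hVd, ENNReal.ofReal_toReal]
      exact ENNReal.rpow_ne_top_of_nonneg (by norm_num) hV.ne
    have hV0 : 0 ≤ V := ENNReal.toReal_nonneg
    refine ⟨η / (V + 1), by positivity, ?_⟩
    rw [hVt, ← ENNReal.ofReal_mul (by positivity)]
    apply ENNReal.ofReal_le_ofReal
    rw [div_mul_eq_mul_div, div_le_iff₀ (by positivity)]
    nlinarith
  have hu := hs.uniformContinuous_of_continuous hF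
  obtain ⟨δ, hδ, hδ'⟩ := Metric.uniformContinuous_iff.1 hu ε hε
  refine ⟨min 1 δ, by positivity, fun b hb => ?_⟩
  have hpt : ∀ x, ‖(Mol b F - F) x‖ ≤ ‖K.indicator (fun _ => ε) x‖ := by
    intro x
    rw [Pi.sub_apply, ← dist_eq_norm]
    by_cases hx : x ∈ K
    · rw [indicator_of_mem hx, Real.norm_of_nonneg hε.le]
      refine b.dist_normed_convolution_le hF.aestronglyMeasurable fun y hy => ?_
      exact (hδ' ((mem_ball.1 hy).trans_le (hb.trans (min_le_right _ _)))).le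
    · rw [indicator_of_notMem hx, norm_zero]
      refine b.dist_normed_convolution_le hF.aestronglyMeasurable fun y hy => ?_
      have hz : ∀ z, z ∈ ball x 1 → F z = 0 := by
        intro z hz
        by_contra hne
        apply hx
        have : z ∈ tsupport F := subset_tsupport _ hne
        exact mem_cthickening_of_dist_le x z 1 _ this (by rw [dist_comm]; exact (mem_ball.1 hz).le)
      rw [hz y (mem_ball.2 ((mem_ball.1 hy).trans_le (hb.trans (min_le_left _ _)))),
        hz x (mem_ball_self one_pos), dist_self]
  refine (eLpNorm_mono hpt).trans ?_
  rw [eLpNorm_indicator_const hKc.measurableSet (by simp) (by simp)]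
  rw [Real.enorm_of_nonneg hε.le]
  simpa using hεη

lemma Mol_close {E' : Type*} [NormedAddCommGroup E'] [NormedSpace ℝ E']
    (b : ContDiffBump (0 : Euc d)) (F F₀ U : Euc d → E') (hF : Continuous F) (hF₀ : Continuous F₀)
    (hc : Continuous (Mol b F)) (hc₀ : Continuous (Mol b F₀))
    (hU : AEStronglyMeasurable U volume) {e : ℝ≥0∞}
    (h1 : eLpNorm (U - F) 2 volume ≤ e) (h2 : eLpNorm (U - F₀) 2 volume ≤ e)
    (h3 : eLpNorm (Mol b F₀ - F₀) 2 volume ≤ e) :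
    eLpNorm (Mol b F - U) 2 volume ≤ 4 * e := by
  have e1 : eLpNorm (F - F₀) 2 volume ≤ e + e := by
    have : F - F₀ = (U - F₀) - (U - F) := by abel
    rw [this]
    refine (eLpNorm_sub_le (hU.sub hF₀.aestronglyMeasurable) (hU.sub hF.aestronglyMeasurable)
      (by norm_num)).trans (add_le_add h2 h1)
  have e2 : eLpNorm (Mol b F - Mol b F₀) 2 volume ≤ e + e := by
    rw [← Mol_sub b F F₀ hF hF₀]
    exact (Mol_eLpNorm_le b _ (hF.sub hF₀)).trans e1
  have : Mol b F - U = (Mol b F - Mol b F₀) + ((Mol b F₀ - F₀) - (U - F₀)) := by abel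
  rw [this]
  have a1 := hc.aestronglyMeasurable (μ := volume)
  have a2 := hc₀.aestronglyMeasurable (μ := volume)
  have a3 := hF₀.aestronglyMeasurable (μ := volume)
  refine (eLpNorm_add_le (a1.sub a2) ((a2.sub a3).sub (hU.sub a3)) (by norm_num)).trans ?_
  refine (add_le_add e2 ((eLpNorm_sub_le (a2.sub a3) (hU.sub a3) (by norm_num)).trans
    (add_le_add h3 h2))).trans ?_
  ring_nf; exact le_rfl

lemma Mol_sup (b : ContDiffBump (0 : Euc d)) (g : Euc d → ℝ)
    (hg : AEStronglyMeasurable g volume) (x : Euc d) :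
    ‖Mol b g x‖ₑ ≤ eLpNorm (b.normed volume) 2 volume * eLpNorm g 2 volume := by
  have h2 : ∀ G : Euc d → ℝ, eLpNorm G 2 volume = (∫⁻ x, ‖G x‖ₑ ^ (2:ℝ)) ^ (1/2:ℝ) := by
    intro G
    rw [eLpNorm_eq_lintegral_rpow_enorm_toReal (by simp) (by simp)]
    simp
  have hmp : MeasurePreserving (fun t : Euc d => x - t) volume volume :=
    Measure.measurePreserving_sub_left volume x
  have e3 : eLpNorm g 2 volume = eLpNorm (fun t => g (x - t)) 2 volume :=
    (eLpNorm_comp_measurePreserving hg hmp).symm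
  rw [e3, h2, h2, Mol_apply]
  refine (enorm_integral_le_lintegral_enorm _).trans ?_
  have hb := b.continuous_normed (μ := (volume : Measure (Euc d)))
  have e2 := ENNReal.lintegral_mul_le_Lp_mul_Lq (volume : Measure (Euc d)) (p := 2) (q := 2)
      (by constructor <;> norm_num) (f := fun t => ‖b.normed volume t‖ₑ)
      (g := fun t => ‖g (x - t)‖ₑ)
      hb.enorm.measurable.aemeasurable
      (hg.comp_measurePreserving hmp).enorm
  simpa [enorm_smul] using e2

lemma sq_eLp {E' : Type*} [NormedAddCommGroup E'] {f : Euc d → E'} (hf : MemLp f 2 volume) :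
    eLpNorm f 2 volume = ENNReal.ofReal (√ (∫ x, ‖f x‖ ^ 2)) := by
  rw [hf.eLpNorm_eq_integral_rpow_norm (by simp) (by simp), Real.sqrt_eq_rpow]
  simp

lemma H10_seq {D : Set (Euc d)} {u : Euc d → ℝ} (h : MemH10 D u) :
    ∃ φ : ℕ → Euc d → ℝ, (∀ n, TestFun D (φ n)) ∧
      Tendsto (fun n => eLpNorm (u - φ n) 2 volume) atTop (𝓝 0) ∧
      Tendsto (fun n => eLpNorm (gradient u - gradient (φ n)) 2 volume) atTop (𝓝 0) := by
  obtain ⟨h1, h2, φ, hφ, hl⟩ := h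
  have h2' : MemLp (gradient u) 2 volume := h2
  refine ⟨φ, hφ, ?_, ?_⟩
  · have hs : Tendsto (fun n => ENNReal.ofReal (√ (∫ x, ((u x - φ n x) ^ 2 +
        ‖gradient u x - gradient (φ n) x‖ ^ 2)))) atTop (𝓝 0) := by
      have := (ENNReal.continuous_ofReal.tendsto _).comp ((Real.continuous_sqrt.tendsto _).comp hl)
      simpa [Function.comp_def] using this
    refine tendsto_of_tendsto_of_tendsto_of_le_of_le tendsto_const_nhds hs (fun _ => zero_le) ?_
    intro n
    have m1 := h1.sub (hφ n).lp
    have m2 := h2'.sub (hφ n).glp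
    simp only
    rw [sq_eLp m1]
    refine ENNReal.ofReal_le_ofReal (Real.sqrt_le_sqrt ?_)
    have i1 := m1.integrable_norm_pow (by norm_num)
    have i2 := m2.integrable_norm_pow (by norm_num)
    simp only [Pi.sub_apply, Real.norm_eq_abs, sq_abs] at i1 i2 ⊢
    refine integral_mono ?_ ?_ ?_
    · exact_mod_cast i1
    · exact_mod_cast i1.add i2
    · intro x; simp only; nlinarith [sq_nonneg ‖gradient u x - gradient (φ n) x‖]
  · have hs : Tendsto (fun n => ENNReal.ofReal (√ (∫ x, ((u x - φ n x) ^ 2 +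
        ‖gradient u x - gradient (φ n) x‖ ^ 2)))) atTop (𝓝 0) := by
      have := (ENNReal.continuous_ofReal.tendsto _).comp ((Real.continuous_sqrt.tendsto _).comp hl)
      simpa [Function.comp_def] using this
    refine tendsto_of_tendsto_of_tendsto_of_le_of_le tendsto_const_nhds hs (fun _ => zero_le) ?_
    intro n
    have m1 := h1.sub (hφ n).lp
    have m2 := h2'.sub (hφ n).glp
    simp only
    rw [sq_eLp m2]
    refine ENNReal.ofReal_le_ofReal (Real.sqrt_le_sqrt ?_)
    have i1 := m1.integrable_norm_pow (by norm_num)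
    have i2 := m2.integrable_norm_pow (by norm_num)
    simp only [Pi.sub_apply, Real.norm_eq_abs, sq_abs] at i1 i2 ⊢
    refine integral_mono ?_ ?_ ?_
    · exact_mod_cast i2
    · exact_mod_cast i1.add i2
    · intro x; simp only; nlinarith [sq_nonneg (u x - φ n x)]

lemma exists_smooth_approx {D : Set (Euc d)} {u : Euc d → ℝ} (hD : IsOpen D)
    (hcont : ContinuousOn u D) (h : MemH10 D u) {K : Set (Euc d)} (hK : IsCompact K)
    (hKD : K ⊆ D) {η : ℝ} (hη : 0 < η) :
    ∃ v : Euc d → ℝ, ContDiff ℝ (⊤ : ℕ∞) v ∧ (∀ x ∈ K, |v x - u x| ≤ η) ∧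
      eLpNorm (v - u) 2 volume ≤ ENNReal.ofReal η ∧
      eLpNorm (gradient v - gradient u) 2 volume ≤ ENNReal.ofReal η := by
  obtain ⟨φ, hφ, hl1, hl2⟩ := H10_seq h
  have h2' : MemLp (gradient u) 2 volume := h.2.1
  have hη4 : 0 < η / 4 := by positivity
  have e4 : 4 * ENNReal.ofReal (η / 4) = ENNReal.ofReal η := by
    rw [show (4 : ℝ≥0∞) = ENNReal.ofReal 4 by simp, ← ENNReal.ofReal_mul (by norm_num)]
    congr 1; ring
  have ev1 := hl1.eventually_le_const (u := ENNReal.ofReal (η / 4)) (by simpa using hη4)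
  have ev2 := hl2.eventually_le_const (u := ENNReal.ofReal (η / 4)) (by simpa using hη4)
  obtain ⟨m₀, hm1, hm2⟩ := (ev1.and ev2).exists
  obtain ⟨r1, hr1, H1⟩ := Mol_tendsto (φ m₀) (hφ m₀).1.continuous (hφ m₀).2.1 hη4
  obtain ⟨r2, hr2, H2⟩ := Mol_tendsto (gradient (φ m₀)) (hφ m₀).cg (hφ m₀).sg hη4
  obtain ⟨r, hr, hrD⟩ := hK.exists_cthickening_subset_open hD hKD
  have huc : UniformContinuousOn u (cthickening r K) :=
    hK.cthickening.uniformContinuousOn_of_continuous (hcont.mono hrD)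
  obtain ⟨δ, hδ, hδ'⟩ := Metric.uniformContinuousOn_iff.1 huc (η / 2) (by positivity)
  set R := min (min r1 r2) (min r δ) with hR
  have hR0 : 0 < R := by positivity
  let b : ContDiffBump (0 : Euc d) := ⟨R / 2, R, by positivity, by linarith⟩
  have hbR : b.rOut = R := rfl
  have hbm : MemLp (b.normed volume) 2 volume :=
    b.continuous_normed.memLp_of_hasCompactSupport b.hasCompactSupport_normed
  have ev3 : ∀ᶠ n in atTop, eLpNorm (b.normed volume) 2 volume * eLpNorm (u - φ n) 2 volume
      ≤ ENNReal.ofReal (η / 2) := by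
    have : Tendsto (fun n => eLpNorm (b.normed volume) 2 volume * eLpNorm (u - φ n) 2 volume)
        atTop (𝓝 (eLpNorm (b.normed volume) 2 volume * 0)) :=
      ENNReal.Tendsto.const_mul hl1 (Or.inr hbm.eLpNorm_lt_top.ne)
    rw [mul_zero] at this
    exact this.eventually_le_const (by simpa using hη)
  obtain ⟨m, hma, hmb, hmc⟩ := (ev1.and (ev2.and ev3)).exists
  refine ⟨Mol b (φ m), Mol_contDiff (hφ m) b, ?_, ?_, ?_⟩
  · intro x hx
    have d1 : dist (Mol b u x) (u x) ≤ η / 2 := by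
      refine b.dist_normed_convolution_le h.1.1 fun y hy => ?_
      have hy' := mem_ball.1 hy
      rw [hbR] at hy'
      refine (hδ' y ?_ x (self_subset_cthickening K hx) ?_).le
      · exact mem_cthickening_of_dist_le y x r K hx (hy'.le.trans (by simp [hR]))
      · exact hy'.trans_le (by simp [hR])
    have d2 : Mol b (u - φ m) x = Mol b u x - Mol b (φ m) x := by
      simp only [Pi.sub_apply, Mol_apply, smul_sub]
      have hmp : MeasurePreserving (fun t : Euc d => x - t) volume volume :=
        Measure.measurePreserving_sub_left volume x
      apply integral_sub
      · exact hbm.integrable_mul (h.1.comp_measurePreserving hmp)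
      · exact hbm.integrable_mul ((hφ m).lp.comp_measurePreserving hmp)
    have d3 : |Mol b (u - φ m) x| ≤ η / 2 := by
      have := (Mol_sup b (u - φ m) (h.1.1.sub (hφ m).lp.1) x).trans hmc
      rw [← Real.norm_eq_abs, ← toReal_enorm]
      exact ENNReal.toReal_le_of_le_ofReal (by positivity) this
    rw [d2] at d3
    rw [Real.dist_eq] at d1
    rw [abs_le] at *
    constructor <;> linarith [d1.1, d1.2, d3.1, d3.2]
  · rw [← e4]
    refine Mol_close b (φ m) (φ m₀) u (hφ m).1.continuous (hφ m₀).1.continuous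
      (Mol_contDiff (hφ m) b).continuous (Mol_contDiff (hφ m₀) b).continuous h.1.1 hma hm1
      (H1 b (by simp [hbR, hR]))
  · rw [← e4, Mol_grad (hφ m)]
    have hc : ∀ n, Continuous (Mol b (gradient (φ n))) := by
      intro n
      rw [← Mol_grad (hφ n)]
      exact (InnerProductSpace.toDual ℝ (Euc d)).symm.continuous.comp
        ((Mol_contDiff (hφ n) b).continuous_fderiv (by simp))
    exact Mol_close b _ (gradient (φ m₀)) _ (hφ m).cg (hφ m₀).cg (hc m) (hc m₀) h2'.1 hmb hm2
      (H2 b (by simp [hbR, hR]))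


lemma eLp_dct {E' : Type*} [NormedAddCommGroup E'] {G : Type*} [NormedAddCommGroup G]
    {g : ℕ → Euc d → E'} {g₀ : Euc d → E'} {F : Euc d → G} {C : ℝ}
    (hF : MemLp F 2 volume) (hg : ∀ n, AEStronglyMeasurable (g n) volume)
    (hg₀ : AEStronglyMeasurable g₀ volume)
    (hb : ∀ n, ∀ᵐ x, ‖g n x - g₀ x‖ ≤ C * ‖F x‖)
    (hl : ∀ᵐ x, Tendsto (fun n => g n x) atTop (𝓝 (g₀ x))) :
    Tendsto (fun n => eLpNorm (g n - g₀) 2 volume) atTop (𝓝 0) := by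
  have h2 : ∀ n, eLpNorm (g n - g₀) 2 volume = (∫⁻ x, ‖g n x - g₀ x‖ₑ ^ (2:ℝ)) ^ (1/2:ℝ) := by
    intro n
    rw [eLpNorm_eq_lintegral_rpow_enorm_toReal (by simp) (by simp)]
    simp
  simp_rw [h2]
  have key : Tendsto (fun n => ∫⁻ x, ‖g n x - g₀ x‖ₑ ^ (2:ℝ)) atTop
      (𝓝 (∫⁻ x : Euc d, (0 : ℝ≥0∞))) := by
    refine tendsto_lintegral_of_dominated_convergence'
      (fun x => (ENNReal.ofReal C * ‖F x‖ₑ) ^ (2:ℝ)) ?_ ?_ ?_ ?_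
    · intro n
      exact (((hg n).sub hg₀).enorm.pow_const _)
    · intro n
      filter_upwards [hb n] with x hx
      gcongr
      rw [← ofReal_norm, ← ofReal_norm,
        ← ENNReal.ofReal_mul' (norm_nonneg _)]
      exact ENNReal.ofReal_le_ofReal hx
    · simp_rw [ENNReal.mul_rpow_of_nonneg _ _ (show (0:ℝ) ≤ 2 by norm_num)]
      rw [lintegral_const_mul' _ _ (by simp)]
      apply ENNReal.mul_ne_top (by simp)
      have := lintegral_rpow_enorm_lt_top_of_eLpNorm_lt_top (p := 2) (by simp) (by simp)
        hF.eLpNorm_lt_top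
      simpa using this.ne
    · filter_upwards [hl] with x hx
      have h0 : Tendsto (fun n => ‖g n x - g₀ x‖ₑ) atTop (𝓝 0) := by
        have := (hx.sub_const (g₀ x)).enorm
        simpa using this
      have := (ENNReal.continuous_rpow_const (y := 2)).tendsto 0 |>.comp h0
      simpa [Function.comp_def] using this
  have := ((ENNReal.continuous_rpow_const (y := (1/2:ℝ))).tendsto _).comp key
  simpa [Function.comp_def] using this

lemma eLp_mul {E' : Type*} [NormedAddCommGroup E'] [NormedSpace ℝ E']
    {F : ℕ → Euc d → E'} {F₀ : Euc d → E'} {a : ℕ → Euc d → ℝ} {a₀ : Euc d → ℝ} {C : ℝ}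
    (_hC : 0 ≤ C)
    (hF₀ : MemLp F₀ 2 volume) (hF : ∀ n, AEStronglyMeasurable (F n) volume)
    (ha : ∀ n, AEStronglyMeasurable (a n) volume) (ha₀ : AEStronglyMeasurable a₀ volume)
    (hb : ∀ n x, |a n x| ≤ C) (hb₀ : ∀ x, |a₀ x| ≤ C)
    (hl : ∀ᵐ x, Tendsto (fun n => a n x) atTop (𝓝 (a₀ x)))
    (hFl : Tendsto (fun n => eLpNorm (F n - F₀) 2 volume) atTop (𝓝 0)) :
    Tendsto (fun n => eLpNorm ((fun x => a n x • F n x) - (fun x => a₀ x • F₀ x)) 2 volume)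
      atTop (𝓝 0) := by
  have t1 : Tendsto (fun n => eLpNorm ((fun x => a n x • F₀ x) - (fun x => a₀ x • F₀ x)) 2 volume)
      atTop (𝓝 0) := by
    refine eLp_dct (C := 2 * C) hF₀ (fun n => (ha n).smul hF₀.1) (ha₀.smul hF₀.1) ?_ ?_
    · intro n
      refine ae_of_all _ fun x => ?_
      rw [← sub_smul, norm_smul]
      gcongr
      rw [Real.norm_eq_abs]
      refine (abs_sub _ _).trans ?_
      linarith [hb n x, hb₀ x]
    · filter_upwards [hl] with x hx
      exact hx.smul_const _
  have t2 : Tendsto (fun n => ENNReal.ofReal C * eLpNorm (F n - F₀) 2 volume) atTop (𝓝 0) := by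
    have := ENNReal.Tendsto.const_mul (a := ENNReal.ofReal C) hFl (Or.inr (by simp))
    simpa using this
  have t3 := t2.add t1
  rw [add_zero] at t3
  refine tendsto_of_tendsto_of_tendsto_of_le_of_le tendsto_const_nhds t3 (fun _ => zero_le) ?_
  intro n
  have e : ((fun x => a n x • F n x) - (fun x => a₀ x • F₀ x)) =
      (fun x => a n x • (F n - F₀) x) + ((fun x => a n x • F₀ x) - (fun x => a₀ x • F₀ x)) := by
    ext x; simp [smul_sub]
  simp only
  rw [e]
  refine (eLpNorm_add_le ((ha n).smul ((hF n).sub hF₀.1))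
    (((ha n).smul hF₀.1).sub (ha₀.smul hF₀.1)) (by norm_num)).trans ?_
  refine add_le_add ?_ le_rfl
  refine (eLpNorm_le_mul_eLpNorm_of_ae_le_mul (c := C) (ae_of_all _ fun x => ?_) 2)
  rw [Pi.smul_apply', norm_smul]
  gcongr
  exact hb n x

lemma exists_cutoff : ∃ θ : ℝ → ℝ, ContDiff ℝ (⊤ : ℕ∞) θ ∧ (∀ s ≤ 1, θ s = 0) ∧
    (∀ s, |θ s| ≤ 1) ∧ (∀ s, 2 ≤ s → θ s = 1) ∧ (∀ s, 2 < s → deriv θ s = 0) ∧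
    ∃ M : ℝ, ∀ s, |deriv θ s| ≤ M ∧ |s * deriv θ s| ≤ M := by
  let θ : ℝ → ℝ := fun s => Real.smoothTransition (s - 1)
  have hθ : ContDiff ℝ (⊤ : ℕ∞) θ := Real.smoothTransition.contDiff.comp (by fun_prop)
  have h0 : ∀ s ≤ 1, θ s = 0 := fun s hs => Real.smoothTransition.zero_of_nonpos (by linarith)
  have h1 : ∀ s, 2 ≤ s → θ s = 1 := fun s hs => Real.smoothTransition.one_of_one_le (by linarith)
  have d1 : ∀ s, 2 < s → deriv θ s = 0 := by
    intro s hs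
    have : θ =ᶠ[𝓝 s] fun _ => 1 := by
      filter_upwards [lt_mem_nhds hs] with y hy using h1 y hy.le
    rw [this.deriv_eq]; simp
  have d0 : ∀ s, s < 1 → deriv θ s = 0 := by
    intro s hs
    have : θ =ᶠ[𝓝 s] fun _ => 0 := by
      filter_upwards [gt_mem_nhds hs] with y hy using h0 y hy.le
    rw [this.deriv_eq]; simp
  have hc : Continuous (deriv θ) := hθ.continuous_deriv (by simp)
  obtain ⟨M, hM⟩ := (isCompact_Icc (a := (1:ℝ)) (b := 2)).exists_bound_of_continuousOn
    hc.continuousOn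
  refine ⟨θ, hθ, h0, ?_, h1, d1, 2 * M, ?_⟩
  · intro s
    rw [abs_of_nonneg (Real.smoothTransition.nonneg _)]
    exact Real.smoothTransition.le_one _
  · have hM0 : 0 ≤ M := (norm_nonneg _).trans (hM 1 (by norm_num))
    intro s
    by_cases hs : s ∈ Icc (1:ℝ) 2
    · have := hM s hs
      rw [Real.norm_eq_abs] at this
      constructor
      · linarith
      · rw [abs_mul]
        have : |s| ≤ 2 := by rw [abs_le]; constructor <;> linarith [hs.1, hs.2]
        gcongr
    · have : deriv θ s = 0 := by
        rw [mem_Icc, not_and_or, not_le, not_le] at hs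
        rcases hs with hs | hs
        · exact d0 s hs
        · exact d1 s hs
      rw [this]; simp [hM0]

lemma ksin_lip {k : ℝ} (hk : 0 < k) (s t : ℝ) :
    |k * Real.sin (s / k) - k * Real.sin (t / k)| ≤ |s - t| := by
  rw [← mul_sub, abs_mul, abs_of_pos hk]
  have : |Real.sin (s / k) - Real.sin (t / k)| ≤ |s / k - t / k| := by
    have := Real.lipschitzWith_sin.dist_le_mul (s / k) (t / k)
    simpa [Real.dist_eq] using this
  calc k * _ ≤ k * |s / k - t / k| := by gcongr
    _ = |s - t| := by rw [← sub_div, abs_div, abs_of_pos hk]; field_simp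

lemma ksin_le {k : ℝ} (hk : 0 < k) (s : ℝ) : |k * Real.sin (s / k)| ≤ |s| := by
  simpa using ksin_lip hk s 0

lemma ksin_le' {k : ℝ} (hk : 0 < k) (s : ℝ) : |k * Real.sin (s / k)| ≤ k := by
  rw [abs_mul, abs_of_pos hk]
  have := Real.abs_sin_le_one (s / k)
  nlinarith

lemma grad_prod {v φ : Euc d → ℝ} {θ : ℝ → ℝ} {k : ℝ} (hk : 0 < k) (hv : Differentiable ℝ v)
    (hφ : Differentiable ℝ φ) (hθ : Differentiable ℝ θ) :
    gradient (fun x => θ (k * v x) * (k * Real.sin (φ x / k))) =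
      fun x => (k * deriv θ (k * v x) * (k * Real.sin (φ x / k))) • gradient v x +
        (θ (k * v x) * Real.cos (φ x / k)) • gradient φ x := by
  refine gradient_eq fun x => ?_
  rw [hasGradientAt_iff_hasFDerivAt]
  have h1 : HasFDerivAt (fun x => θ (k * v x)) (deriv θ (k * v x) • (k • fderiv ℝ v x)) x :=
    (hθ (k * v x)).hasDerivAt.comp_hasFDerivAt x ((hv x).hasFDerivAt.const_mul k)
  have h2 : HasFDerivAt (fun x => Real.sin (φ x / k))
      (Real.cos (φ x / k) • (k⁻¹ • fderiv ℝ φ x)) x := by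
    have h3 : HasFDerivAt (fun x => φ x / k) (k⁻¹ • fderiv ℝ φ x) x := by
      simpa [div_eq_inv_mul] using (hφ x).hasFDerivAt.const_mul k⁻¹
    exact (Real.hasDerivAt_sin _).comp_hasFDerivAt x h3
  refine HasFDerivAt.congr_fderiv (h1.mul (h2.const_mul k)) ?_
  simp only [map_add, map_smul, toDual_gradient]
  ext w
  simp
  field_simp
  ring


lemma ae_sub {f : ℕ → Euc d → ℝ} {g : Euc d → ℝ} (hf : ∀ n, AEStronglyMeasurable (f n) volume)
    (hg : AEStronglyMeasurable g volume)
    (h : Tendsto (fun n => eLpNorm (f n - g) 2 volume) atTop (𝓝 0)) :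
    ∃ ns : ℕ → ℕ, StrictMono ns ∧ ∀ᵐ x, Tendsto (fun i => f (ns i) x) atTop (𝓝 (g x)) :=
  (tendstoInMeasure_of_tendsto_eLpNorm (by simp) hf hg h).exists_seq_tendsto_ae

lemma contDiff_gradient {v : Euc d → ℝ} (hv : ContDiff ℝ (⊤ : ℕ∞) v) : Continuous (gradient v) :=
  (InnerProductSpace.toDual ℝ (Euc d)).symm.continuous.comp (hv.continuous_fderiv (by simp))

lemma stage1 {D : Set (Euc d)} {u : Euc d → ℝ} (hD : IsOpen D)
    (hcont : ContinuousOn u D) (h : MemH10 D u) {θ : ℝ → ℝ} (hθ : ContDiff ℝ (⊤ : ℕ∞) θ)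
    (hθ0 : ∀ s ≤ 1, θ s = 0) (hθ1 : ∀ s, |θ s| ≤ 1) {M : ℝ} (hM : ∀ s, |deriv θ s| ≤ M)
    {k : ℝ} (hk : 0 < k) :
    ∃ ψ : ℕ → Euc d → ℝ, (∀ n, TestFun (Om D u) (ψ n)) ∧
      Tendsto (fun n => eLpNorm (ψ n - fun x => θ (k * u x) * (k * Real.sin (u x / k))) 2 volume)
        atTop (𝓝 0) ∧
      Tendsto (fun n => eLpNorm (gradient (ψ n) - fun x =>
        (k * deriv θ (k * u x) * (k * Real.sin (u x / k)) + θ (k * u x) * Real.cos (u x / k)) •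
          gradient u x) 2 volume) atTop (𝓝 0) := by
  obtain ⟨φ, hφ, hl1, hl2⟩ := H10_seq h
  have hug : MemLp (gradient u) 2 volume := h.2.1
  have hum := h.1.1
  have hη : ∀ n : ℕ, 0 < min (1 / (2 * k)) (1 / ((n : ℝ) + 1)) := fun n => by positivity
  choose v hv1 hv2 hv3 hv4 using fun n =>
    exists_smooth_approx hD hcont h (hφ n).2.1.isCompact (hφ n).2.2 (hη n)
  have hz : Tendsto (fun n : ℕ => ENNReal.ofReal (min (1 / (2 * k)) (1 / ((n : ℝ) + 1)))) atTop
      (𝓝 0) := by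
    have h1 : Tendsto (fun n : ℕ => ENNReal.ofReal (1 / ((n : ℝ) + 1))) atTop (𝓝 0) := by
      have := (ENNReal.continuous_ofReal.tendsto 0).comp
        (tendsto_one_div_add_atTop_nhds_zero_nat (𝕜 := ℝ))
      simpa [Function.comp_def] using this
    exact tendsto_of_tendsto_of_tendsto_of_le_of_le tendsto_const_nhds h1 (fun _ => zero_le)
      (fun n => ENNReal.ofReal_le_ofReal (min_le_right _ _))
  have lv : Tendsto (fun n => eLpNorm (v n - u) 2 volume) atTop (𝓝 0) :=
    tendsto_of_tendsto_of_tendsto_of_le_of_le tendsto_const_nhds hz (fun _ => zero_le) hv3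
  have lvg : Tendsto (fun n => eLpNorm (gradient (v n) - gradient u) 2 volume) atTop (𝓝 0) :=
    tendsto_of_tendsto_of_tendsto_of_le_of_le tendsto_const_nhds hz (fun _ => zero_le) hv4
  have lf : Tendsto (fun n => eLpNorm (φ n - u) 2 volume) atTop (𝓝 0) := by
    simpa only [eLpNorm_sub_comm] using hl1
  have lfg : Tendsto (fun n => eLpNorm (gradient (φ n) - gradient u) 2 volume) atTop (𝓝 0) := by
    simpa only [eLpNorm_sub_comm] using hl2
  obtain ⟨ns, hns, ae1⟩ := ae_sub (fun n => (hφ n).lp.1) hum lf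
  obtain ⟨ms, hms, ae2⟩ := ae_sub (f := fun n => v (ns n))
    (fun n => (hv1 (ns n)).continuous.aestronglyMeasurable) hum (lv.comp hns.tendsto_atTop)
  set q : ℕ → ℕ := fun n => ns (ms n) with hq
  have hqt : Tendsto q atTop atTop := hns.tendsto_atTop.comp hms.tendsto_atTop
  have ae1' : ∀ᵐ x, Tendsto (fun i => φ (q i) x) atTop (𝓝 (u x)) := by
    filter_upwards [ae1] with x hx using hx.comp hms.tendsto_atTop
  have cθ := hθ.continuous
  have cθ' : Continuous (deriv θ) := hθ.continuous_deriv (by simp)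
  have cφ := fun n => (hφ n).1.continuous
  have cv := fun n => (hv1 n).continuous
  have hM0 : 0 ≤ M := (abs_nonneg _).trans (hM 0)
  refine ⟨fun n x => θ (k * v (q n) x) * (k * Real.sin (φ (q n) x / k)), ?_, ?_, ?_⟩
  · intro n
    refine ⟨?_, ?_, ?_⟩
    · exact (hθ.comp (contDiff_const.mul (hv1 _))).mul
        (contDiff_const.mul (Real.contDiff_sin.comp ((hφ _).1.div_const _)))
    · refine HasCompactSupport.mul_left ?_
      exact (hφ (q n)).2.1.comp_left (g := fun s => k * Real.sin (s / k)) (by simp)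
    · have hcl : IsClosed (tsupport (φ (q n)) ∩ {x | 1 / k ≤ v (q n) x}) :=
        (isClosed_tsupport _).inter (isClosed_le continuous_const (cv _))
      have hsub : Function.support (fun x => θ (k * v (q n) x) * (k * Real.sin (φ (q n) x / k))) ⊆
          tsupport (φ (q n)) ∩ {x | 1 / k ≤ v (q n) x} := by
        intro x hx
        rw [Function.mem_support] at hx
        constructor
        · apply subset_tsupport
          rw [Function.mem_support]
          intro h0
          apply hx; simp [h0]
        · by_contra hlt
          apply hx
          simp only [mem_ofPred_eq, not_le] at hlt
          rw [hθ0 _ _, zero_mul]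
          rw [lt_div_iff₀ hk] at hlt
          linarith
      refine (closure_minimal hsub hcl).trans ?_
      rintro x ⟨hx1, hx2⟩
      refine ⟨(hφ (q n)).2.2 hx1, ?_⟩
      have := (abs_le.1 ((hv2 (q n) x hx1).trans (min_le_left _ _))).2
      simp only [mem_ofPred_eq] at hx2
      have hk2 : 1 / (2 * k) < 1 / k := by
        apply one_div_lt_one_div_of_lt hk; linarith
      intro h0
      linarith
  · have hsm : AEStronglyMeasurable (fun x => k * Real.sin (u x / k)) volume :=
      (show Continuous fun s : ℝ => k * Real.sin (s / k) by fun_prop).comp_aestronglyMeasurable hum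
    refine eLp_mul (C := 1) (F := fun n x => k * Real.sin (φ (q n) x / k))
      (F₀ := fun x => k * Real.sin (u x / k)) (a := fun n x => θ (k * v (q n) x))
      (a₀ := fun x => θ (k * u x)) zero_le_one ?_ ?_ ?_ ?_ (fun _ _ => hθ1 _) (fun _ => hθ1 _) ?_ ?_
    · exact h.1.mono hsm (ae_of_all _ fun x => ksin_le hk _)
    · intro n
      have := cφ (q n)
      exact Continuous.aestronglyMeasurable (by fun_prop)
    · intro n
      have := cv (q n)
      exact Continuous.aestronglyMeasurable (by fun_prop)
    · exact (show Continuous fun s : ℝ => θ (k * s) by fun_prop).comp_aestronglyMeasurable hum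
    · filter_upwards [ae2] with x hx
      exact ((show Continuous fun s : ℝ => θ (k * s) by fun_prop).tendsto _).comp hx
    · refine tendsto_of_tendsto_of_tendsto_of_le_of_le tendsto_const_nhds (lf.comp hqt)
        (fun _ => zero_le) ?_
      intro n
      exact eLpNorm_mono fun x => ksin_lip hk _ _
  · have G1 : Tendsto (fun n => eLpNorm ((fun x => (k * deriv θ (k * v (q n) x) *
        (k * Real.sin (φ (q n) x / k))) • gradient (v (q n)) x) -
        fun x => (k * deriv θ (k * u x) * (k * Real.sin (u x / k))) • gradient u x) 2 volume)
        atTop (𝓝 0) := by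
      have bd : ∀ s t : ℝ, |k * deriv θ s * (k * Real.sin (t / k))| ≤ k * M * k := by
        intro s t
        rw [abs_mul, abs_mul, abs_of_pos hk]
        exact mul_le_mul (by gcongr; exact hM s) (ksin_le' hk t) (abs_nonneg _) (by positivity)
      refine eLp_mul (C := k * M * k) (F := fun n => gradient (v (q n))) (by positivity) hug ?_ ?_ ?_
        (fun _ _ => bd _ _) (fun _ => bd _ _) ?_ (lvg.comp hqt)
      · exact fun n => (contDiff_gradient (hv1 _)).aestronglyMeasurable
      · intro n
        have := cv (q n)
        have := cφ (q n)
        exact Continuous.aestronglyMeasurable (by fun_prop)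
      · exact (show Continuous fun s : ℝ => k * deriv θ (k * s) * (k * Real.sin (s / k)) by
          fun_prop).comp_aestronglyMeasurable hum
      · filter_upwards [ae1', ae2] with x hx1 hx2
        exact ((show Continuous fun p : ℝ × ℝ => k * deriv θ (k * p.1) * (k * Real.sin (p.2 / k)) by
          fun_prop).tendsto (u x, u x)).comp (hx2.prodMk_nhds hx1)
    have G2 : Tendsto (fun n => eLpNorm ((fun x => (θ (k * v (q n) x) *
        Real.cos (φ (q n) x / k)) • gradient (φ (q n)) x) -
        fun x => (θ (k * u x) * Real.cos (u x / k)) • gradient u x) 2 volume)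
        atTop (𝓝 0) := by
      have bd : ∀ s t : ℝ, |θ s * Real.cos t| ≤ 1 := by
        intro s t
        rw [abs_mul]
        exact mul_le_one₀ (hθ1 s) (abs_nonneg _) (Real.abs_cos_le_one t)
      refine eLp_mul (C := 1) (F := fun n => gradient (φ (q n))) (by positivity) hug ?_ ?_ ?_
        (fun _ _ => bd _ _) (fun _ => bd _ _) ?_ (lfg.comp hqt)
      · exact fun n => (hφ _).cg.aestronglyMeasurable
      · intro n
        have := cv (q n)
        have := cφ (q n)
        exact Continuous.aestronglyMeasurable (by fun_prop)
      · exact (show Continuous fun s : ℝ => θ (k * s) * Real.cos (s / k) by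
          fun_prop).comp_aestronglyMeasurable hum
      · filter_upwards [ae1', ae2] with x hx1 hx2
        exact ((show Continuous fun p : ℝ × ℝ => θ (k * p.1) * Real.cos (p.2 / k) by
          fun_prop).tendsto (u x, u x)).comp (hx2.prodMk_nhds hx1)
    have G3 := G1.add G2
    rw [add_zero] at G3
    refine tendsto_of_tendsto_of_tendsto_of_le_of_le tendsto_const_nhds G3 (fun _ => zero_le) ?_
    intro n
    simp only
    rw [grad_prod hk ((hv1 _).differentiable (by simp)) (hφ _).diff (hθ.differentiable (by simp))]
    have cgv := contDiff_gradient (hv1 (q n))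
    have cgf := (hφ (q n)).cg
    have := cv (q n)
    have := cφ (q n)
    have m1 : AEStronglyMeasurable (fun x => (k * deriv θ (k * v (q n) x) *
        (k * Real.sin (φ (q n) x / k))) • gradient (v (q n)) x) volume :=
      Continuous.aestronglyMeasurable (by fun_prop)
    have m2 : AEStronglyMeasurable (fun x => (θ (k * v (q n) x) *
        Real.cos (φ (q n) x / k)) • gradient (φ (q n)) x) volume :=
      Continuous.aestronglyMeasurable (by fun_prop)
    have m3 : AEStronglyMeasurable (fun x => (k * deriv θ (k * u x) *
        (k * Real.sin (u x / k))) • gradient u x) volume :=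
      ((show Continuous fun s : ℝ => k * deriv θ (k * s) * (k * Real.sin (s / k)) by
          fun_prop).comp_aestronglyMeasurable hum).smul hug.1
    have m4 : AEStronglyMeasurable (fun x => (θ (k * u x) * Real.cos (u x / k)) •
        gradient u x) volume :=
      ((show Continuous fun s : ℝ => θ (k * s) * Real.cos (s / k) by
          fun_prop).comp_aestronglyMeasurable hum).smul hug.1
    refine le_trans (le_of_eq ?_) (eLpNorm_add_le (m1.sub m3) (m2.sub m4) (by norm_num))
    congr 1
    ext1 x
    simp only [Pi.sub_apply, Pi.add_apply, add_smul]
    abel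


lemma zero_off {E' : Type*} [NormedAddCommGroup E'] {D : Set (Euc d)} (hD : IsOpen D)
    {F : ℕ → Euc d → E'} {U : Euc d → E'} (hU : AEStronglyMeasurable U volume)
    (h0 : ∀ n, ∀ x ∉ D, F n x = 0)
    (h : Tendsto (fun n => eLpNorm (U - F n) 2 volume) atTop (𝓝 0)) :
    ∀ᵐ x, x ∉ D → U x = 0 := by
  have key : eLpNorm U 2 (volume.restrict Dᶜ) = 0 := by
    refine le_antisymm (ge_of_tendsto' h fun n => ?_) zero_le
    calc eLpNorm U 2 (volume.restrict Dᶜ) = eLpNorm (U - F n) 2 (volume.restrict Dᶜ) := by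
          apply eLpNorm_congr_ae
          filter_upwards [ae_restrict_mem hD.measurableSet.compl] with x hx
          simp [h0 n x hx]
      _ ≤ _ := eLpNorm_mono_measure _ Measure.restrict_le_self
  rw [eLpNorm_eq_zero_iff hU.restrict (by simp)] at key
  have := (ae_restrict_iff' hD.measurableSet.compl).1 key
  filter_upwards [this] with x hx h using hx h

lemma TestFun.zero_off {D : Set (Euc d)} {φ : Euc d → ℝ} (h : TestFun D φ) {x : Euc d}
    (hx : x ∉ D) : φ x = 0 := image_eq_zero_of_notMem_tsupport fun h' => hx (h.2.2 h')

lemma TestFun.gzero_off {D : Set (Euc d)} {φ : Euc d → ℝ} (h : TestFun D φ) {x : Euc d}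
    (hx : x ∉ D) : gradient φ x = 0 := by
  have : φ =ᶠ[𝓝 x] fun _ => 0 :=
    notMem_tsupport_iff_eventuallyEq.1 fun h' => hx (h.2.2 h')
  rw [this.gradient_eq]
  simp

lemma ae_dich {D : Set (Euc d)} {u : Euc d → ℝ} (hD : IsOpen D) (hnn : ∀ x ∈ D, 0 ≤ u x)
    (h : MemH10 D u) : ∀ᵐ x, 0 < u x ∨ (u x = 0 ∧ gradient u x = 0) := by
  obtain ⟨φ, hφ, hl1, hl2⟩ := H10_seq h
  have hug : MemLp (gradient u) 2 volume := h.2.1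
  filter_upwards [zero_off hD h.1.1 (fun n x hx => (hφ n).zero_off hx) hl1,
    zero_off hD hug.1 (fun n x hx => (hφ n).gzero_off hx) hl2] with x h1 h2
  by_cases hx : x ∈ D
  · rcases (hnn x hx).lt_or_eq with hp | hp
    · exact Or.inl hp
    · right
      refine ⟨hp.symm, ?_⟩
      have : IsLocalMin u x := by
        filter_upwards [hD.mem_nhds hx] with y hy
        rw [← hp]; exact hnn y hy
      simp [gradient, this.fderiv_eq_zero]
  · exact Or.inr ⟨h1 hx, h2 hx⟩

lemma exists_approx_Om {D : Set (Euc d)} {u : Euc d → ℝ} (hD : IsOpen D)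
    (hcont : ContinuousOn u D) (hnn : ∀ x ∈ D, 0 ≤ u x) (h : MemH10 D u) :
    ∃ ψ : ℕ → Euc d → ℝ, (∀ n, TestFun (Om D u) (ψ n)) ∧
      Tendsto (fun n => eLpNorm (ψ n - u) 2 volume) atTop (𝓝 0) ∧
      Tendsto (fun n => eLpNorm (gradient (ψ n) - gradient u) 2 volume) atTop (𝓝 0) := by
  obtain ⟨θ, hθ, hθ0, hθ1, hθ2, hθ3, M, hM⟩ := exists_cutoff
  have hug : MemLp (gradient u) 2 volume := h.2.1
  have hum := h.1.1
  have hM0 : 0 ≤ M := (abs_nonneg _).trans (hM 0).1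
  have hdich := ae_dich hD hnn h
  have cθ := hθ.continuous
  have cθ' : Continuous (deriv θ) := hθ.continuous_deriv (by simp)
  set κ : ℕ → ℝ := fun n => (n : ℝ) + 1 with hκ
  have hκ0 : ∀ n, 0 < κ n := fun n => by positivity
  have hκt : Tendsto κ atTop atTop :=
    tendsto_atTop_add_const_right _ _ tendsto_natCast_atTop_atTop
  set H : ℕ → Euc d → ℝ := fun n x => θ (κ n * u x) * (κ n * Real.sin (u x / κ n)) with hH
  set A : ℕ → Euc d → ℝ := fun n x => κ n * deriv θ (κ n * u x) * (κ n * Real.sin (u x / κ n)) +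
    θ (κ n * u x) * Real.cos (u x / κ n) with hA
  have mH : ∀ n, AEStronglyMeasurable (H n) volume := fun n =>
    (show Continuous fun s : ℝ => θ (κ n * s) * (κ n * Real.sin (s / κ n)) by
      fun_prop).comp_aestronglyMeasurable hum
  have mA : ∀ n, AEStronglyMeasurable (fun x => A n x • gradient u x) volume := fun n =>
    ((show Continuous fun s : ℝ => κ n * deriv θ (κ n * s) * (κ n * Real.sin (s / κ n)) +
      θ (κ n * s) * Real.cos (s / κ n) by
      fun_prop).comp_aestronglyMeasurable hum).smul hug.1
  have hdiv : ∀ s : ℝ, Tendsto (fun n => s / κ n) atTop (𝓝 0) := fun s => hκt.const_div_atTop s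
  have big : ∀ s : ℝ, 0 < s → ∀ᶠ n in atTop, 2 < κ n * s := fun s hs =>
    (hκt.atTop_mul_const hs).eventually_gt_atTop 2
  have T1 : Tendsto (fun n => eLpNorm (H n - u) 2 volume) atTop (𝓝 0) := by
    refine eLp_dct (C := 2) h.1 mH hum ?_ ?_
    · intro n
      refine ae_of_all _ fun x => ?_
      have : |H n x| ≤ |u x| := by
        rw [hH, abs_mul]
        have := hθ1 (κ n * u x)
        have := ksin_le (hκ0 n) (u x)
        nlinarith [abs_nonneg (θ (κ n * u x)), abs_nonneg (κ n * Real.sin (u x / κ n))]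
      rw [Real.norm_eq_abs, Real.norm_eq_abs]
      refine (abs_sub _ _).trans ?_
      linarith
    · filter_upwards [hdich] with x hx
      rcases hx with hx | ⟨hx, -⟩
      · have e : ∀ᶠ n in atTop, u x * Real.sinc (u x / κ n) = H n x := by
          filter_upwards [big _ hx] with n hn
          have hk := hκ0 n
          rw [hH]
          simp only
          rw [hθ2 _ hn.le, Real.sinc_of_ne_zero (by positivity)]
          field_simp
        refine Tendsto.congr' e ?_
        have := ((Real.continuous_sinc.tendsto 0).comp (hdiv (u x))).const_mul (u x)
        simpa [Function.comp_def] using this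
      · simp [hH, hx]
  have T2 : Tendsto (fun n => eLpNorm ((fun x => A n x • gradient u x) - gradient u) 2 volume)
      atTop (𝓝 0) := by
    refine eLp_dct (C := M + 2) hug mA hug.1 ?_ ?_
    · intro n
      refine ae_of_all _ fun x => ?_
      have b1 : |κ n * deriv θ (κ n * u x) * (κ n * Real.sin (u x / κ n))| ≤ M := by
        have hk := hκ0 n
        refine le_trans ?_ (hM (κ n * u x)).2
        rw [abs_mul (κ n * deriv θ (κ n * u x)), abs_mul (κ n), abs_mul (κ n * u x), abs_mul (κ n) (u x)]
        calc |κ n| * |deriv θ (κ n * u x)| * |κ n * Real.sin (u x / κ n)|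
            ≤ |κ n| * |deriv θ (κ n * u x)| * |u x| := by
              exact mul_le_mul_of_nonneg_left (ksin_le hk _) (by positivity)
          _ = _ := by ring
      have b2 : |θ (κ n * u x) * Real.cos (u x / κ n)| ≤ 1 := by
        rw [abs_mul]
        exact mul_le_one₀ (hθ1 _) (abs_nonneg _) (Real.abs_cos_le_one _)
      have b3 : |A n x - 1| ≤ M + 2 := by
        rw [hA]
        rw [abs_le] at *
        constructor <;> simp only <;> linarith [b1.1, b1.2, b2.1, b2.2]
      calc ‖A n x • gradient u x - gradient u x‖ = ‖(A n x - 1) • gradient u x‖ := by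
            rw [sub_smul, one_smul]
        _ = |A n x - 1| * ‖gradient u x‖ := by rw [norm_smul, Real.norm_eq_abs]
        _ ≤ _ := by gcongr
    · filter_upwards [hdich] with x hx
      rcases hx with hx | ⟨-, hx⟩
      · have e : ∀ᶠ n in atTop, Real.cos (u x / κ n) • gradient u x = A n x • gradient u x := by
          filter_upwards [big _ hx] with n hn
          rw [hA]
          simp only
          rw [hθ2 _ hn.le, hθ3 _ hn]
          simp
        refine Tendsto.congr' e ?_
        have := ((Real.continuous_cos.tendsto 0).comp (hdiv (u x))).smul_const (gradient u x)
        simpa [Function.comp_def] using this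
      · simp [hx]
  have hex : ∀ n : ℕ, ∃ ψ : Euc d → ℝ, TestFun (Om D u) ψ ∧
      eLpNorm (ψ - H n) 2 volume ≤ ENNReal.ofReal (1 / ((n : ℝ) + 1)) ∧
      eLpNorm (gradient ψ - fun x => A n x • gradient u x) 2 volume ≤
        ENNReal.ofReal (1 / ((n : ℝ) + 1)) := by
    intro n
    obtain ⟨ψ, hψ, l1, l2⟩ := stage1 hD hcont h hθ hθ0 hθ1 (fun s => (hM s).1) (hκ0 n)
    have hp : (0 : ℝ≥0∞) < ENNReal.ofReal (1 / ((n : ℝ) + 1)) := by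
      rw [ENNReal.ofReal_pos]; positivity
    obtain ⟨m, h1, h2⟩ := ((l1.eventually_le_const hp).and (l2.eventually_le_const hp)).exists
    exact ⟨ψ m, hψ m, h1, h2⟩
  choose ψ hψ p1 p2 using hex
  have hz : Tendsto (fun n : ℕ => ENNReal.ofReal (1 / ((n : ℝ) + 1))) atTop (𝓝 0) := by
    have := (ENNReal.continuous_ofReal.tendsto 0).comp
      (tendsto_one_div_add_atTop_nhds_zero_nat (𝕜 := ℝ))
    simpa [Function.comp_def] using this
  refine ⟨ψ, hψ, ?_, ?_⟩
  · have := hz.add T1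
    rw [add_zero] at this
    refine tendsto_of_tendsto_of_tendsto_of_le_of_le tendsto_const_nhds this (fun _ => zero_le) ?_
    intro n
    have e : ψ n - u = (ψ n - H n) + (H n - u) := by abel
    simp only
    rw [e]
    exact (eLpNorm_add_le ((hψ n).lp.1.sub (mH n)) ((mH n).sub hum) (by norm_num)).trans
      (add_le_add (p1 n) le_rfl)
  · have := hz.add T2
    rw [add_zero] at this
    refine tendsto_of_tendsto_of_tendsto_of_le_of_le tendsto_const_nhds this (fun _ => zero_le) ?_
    intro n
    have e : gradient (ψ n) - gradient u = (gradient (ψ n) - fun x => A n x • gradient u x) +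
      ((fun x => A n x • gradient u x) - gradient u) := by abel
    simp only
    rw [e]
    exact (eLpNorm_add_le ((hψ n).glp.1.sub (mA n)) ((mA n).sub hug.1) (by norm_num)).trans
      (add_le_add (p2 n) le_rfl)


lemma int_inner {E' : Type*} [NormedAddCommGroup E'] [InnerProductSpace ℝ E']
    {f g : Euc d → E'} (hf : MemLp f 2 volume) (hg : MemLp g 2 volume) :
    ∫ x, ⟪f x, g x⟫ = ⟪hf.toLp f, hg.toLp g⟫ := by
  rw [L2.inner_def]
  refine integral_congr_ae ?_
  filter_upwards [hf.coeFn_toLp, hg.coeFn_toLp] with x h1 h2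
  rw [h1, h2]

lemma L2_tendsto {E' : Type*} [NormedAddCommGroup E'] [InnerProductSpace ℝ E']
    {f g : Euc d → E'} {F G : ℕ → Euc d → E'} (hf : MemLp f 2 volume) (hg : MemLp g 2 volume)
    (hF : ∀ n, MemLp (F n) 2 volume) (hG : ∀ n, MemLp (G n) 2 volume)
    (h1 : Tendsto (fun n => eLpNorm (F n - f) 2 volume) atTop (𝓝 0))
    (h2 : Tendsto (fun n => eLpNorm (G n - g) 2 volume) atTop (𝓝 0)) :
    Tendsto (fun n => ∫ x, ⟪F n x, G n x⟫) atTop (𝓝 (∫ x, ⟪f x, g x⟫)) := by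
  have : Fact ((1:ℝ≥0∞) ≤ 2) := ⟨by norm_num⟩
  rw [int_inner hf hg]
  have e : (fun n => ∫ x, ⟪F n x, G n x⟫) = fun n => ⟪(hF n).toLp (F n), (hG n).toLp (G n)⟫ := by
    ext n; exact int_inner _ _
  rw [e]
  exact ((Lp.tendsto_Lp_iff_tendsto_eLpNorm'' F hF f hf).2 h1).inner
    ((Lp.tendsto_Lp_iff_tendsto_eLpNorm'' G hG g hg).2 h2)

lemma grad_add_smul {f g : Euc d → ℝ} (hf : Differentiable ℝ f) (hg : Differentiable ℝ g) (t : ℝ) :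
    gradient (f + t • g) = gradient f + t • gradient g := by
  ext1 x
  simp only [gradient, Pi.add_apply, Pi.smul_apply]
  rw [fderiv_add (hf x) ((hg x).const_smul t), fderiv_const_smul (hg x)]
  simp

lemma TestFun.mono {A B : Set (Euc d)} {φ : Euc d → ℝ} (h : TestFun A φ) (hAB : A ⊆ B) :
    TestFun B φ := ⟨h.1, h.2.1, h.2.2.trans hAB⟩

lemma TestFun.add_smul {A : Set (Euc d)} {φ ψ : Euc d → ℝ} (h : TestFun A φ) (h' : TestFun A ψ)
    (t : ℝ) : TestFun A (φ + t • ψ) := by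
  refine ⟨h.1.add (contDiff_const.smul h'.1), h.2.1.add (h'.2.1.smul_left), ?_⟩
  refine (tsupport_add φ (t • ψ)).trans (union_subset h.2.2 ?_)
  exact (tsupport_smul_subset_right (fun _ => t) ψ).trans h'.2.2

lemma TestFun.memH10 {A : Set (Euc d)} {φ : Euc d → ℝ} (h : TestFun A φ) : MemH10 A φ :=
  ⟨h.lp, h.glp, fun _ => φ, fun _ => h, by simp⟩

lemma Om_open {D : Set (Euc d)} {u : Euc d → ℝ} (hD : IsOpen D) (hc : ContinuousOn u D) :
    IsOpen (Om D u) := hc.isOpen_inter_preimage hD isOpen_ne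

lemma null_diff {D ω : Set (Euc d)} {u : Euc d → ℝ} (hD : IsOpen D) (hDb : Bornology.IsBounded D)
    (hcont : ContinuousOn u D) (hωD : ω ⊆ D) (hfull : mvol (Om D u ∩ ω) = mvol ω) :
    volume (ω \ Om D u) = 0 := by
  have fin : ∀ s ⊆ D, volume s ≠ ∞ := fun s hs =>
    ((measure_mono hs).trans_lt hDb.measure_lt_top).ne
  have h1 := measure_inter_add_sdiff (μ := volume) ω (Om_open hD hcont).measurableSet
  have h2 : volume (ω ∩ Om D u) = volume ω := by
    rw [inter_comm]
    exact (ENNReal.toReal_eq_toReal_iff' (fin _ (inter_subset_right.trans hωD)) (fin _ hωD)).1 hfull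
  rw [h2] at h1
  exact (ENNReal.add_right_inj (fin _ hωD)).1 (h1.trans (add_zero _).symm)

lemma quad_zero {A B C : ℝ} (h : ∀ t : ℝ, A ≤ A + 2 * t * B + t ^ 2 * C) : B = 0 := by
  by_contra hB
  have hpos : 0 < B ^ 2 := by positivity
  have h2 := h (-B / (|C| + 1))
  have hc : C ≤ |C| := le_abs_self C
  have h0 : 0 < |C| + 1 := by positivity
  have e : A + 2 * (-B / (|C| + 1)) * B + (-B / (|C| + 1)) ^ 2 * C =
    A - B ^ 2 * (2 * (|C| + 1) - C) / (|C| + 1) ^ 2 := by field_simp; ring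
  rw [e] at h2
  have : 0 < B ^ 2 * (2 * (|C| + 1) - C) / (|C| + 1) ^ 2 := by
    have : 0 < 2 * (|C| + 1) - C := by linarith
    positivity
  linarith

lemma quad_int {E' : Type*} [NormedAddCommGroup E'] [InnerProductSpace ℝ E']
    {f g : Euc d → E'} (hf : MemLp f 2 volume) (hg : MemLp g 2 volume) (t : ℝ) :
    ∫ x, ⟪(f + t • g) x, (f + t • g) x⟫ =
      (∫ x, ‖f x‖ ^ 2) + 2 * t * (∫ x, ⟪f x, g x⟫) + t ^ 2 * ∫ x, ‖g x‖ ^ 2 := by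
  have hfg := hf.add (hg.const_smul t)
  have e : ∀ v : E', ‖v‖ ^ 2 = ⟪v, v⟫ := fun v => (real_inner_self_eq_norm_sq v).symm
  simp only [e]
  rw [int_inner hfg hfg, int_inner hf hf, int_inner hg hg, int_inner hf hg]
  rw [MemLp.toLp_add hf (hg.const_smul t), MemLp.toLp_const_smul t hg]
  simp only [inner_add_left, inner_add_right, inner_smul_left, inner_smul_right]
  rw [real_inner_comm (hf.toLp f) (hg.toLp g)]
  simp only [conj_trivial]
  ring

lemma claim1 {D ω : Set (Euc d)} {a lam : ℝ} {u : Euc d → ℝ}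
    (hD : IsOpen D) (hDb : Bornology.IsBounded D) (hu : IsJMinimizer D a lam u)
    (hcont : ContinuousOn u D) (hnn : ∀ x ∈ D, 0 ≤ u x)
    (hωD : ω ⊆ D) (hfull : mvol (Om D u ∩ ω) = mvol ω)
    {φ : Euc d → ℝ} (hφ : TestFun ω φ) :
    (∫ x, ⟪gradient u x, gradient φ x⟫) = lam * ∫ x, u x * φ x := by
  obtain ⟨hH, hle, hmin⟩ := hu
  obtain ⟨ψ, hψ, T1, T2⟩ := exists_approx_Om hD hcont hnn hH
  have hug : MemLp (gradient u) 2 volume := hH.2.1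
  have hul := hH.1
  have hOmD : Om D u ⊆ D := fun x hx => hx.1
  have key : ∀ t : ℝ, Jfun lam u ≤
      (∫ x, ⟪(gradient u + t • gradient φ) x, (gradient u + t • gradient φ) x⟫) -
        lam * ∫ x, ⟪(u + t • φ) x, (u + t • φ) x⟫ := by
    intro t
    have L1 := L2_tendsto (F := fun n => gradient (ψ n) + t • gradient φ)
      (G := fun n => gradient (ψ n) + t • gradient φ)
      (hug.add (hφ.glp.const_smul t)) (hug.add (hφ.glp.const_smul t))
      (fun n => (hψ n).glp.add (hφ.glp.const_smul t))
      (fun n => (hψ n).glp.add (hφ.glp.const_smul t))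
      (by simpa using T2) (by simpa using T2)
    have L2 := L2_tendsto (F := fun n => ψ n + t • φ) (G := fun n => ψ n + t • φ)
      (hul.add (hφ.lp.const_smul t)) (hul.add (hφ.lp.const_smul t))
      (fun n => (hψ n).lp.add (hφ.lp.const_smul t))
      (fun n => (hψ n).lp.add (hφ.lp.const_smul t))
      (by simpa using T1) (by simpa using T1)
    refine ge_of_tendsto' (L1.sub (L2.const_mul lam)) fun n => ?_
    have tw : TestFun D (ψ n + t • φ) := ((hψ n).mono hOmD).add_smul (hφ.mono hωD) t
    have hsub : Om D (ψ n + t • φ) ⊆ Om D u ∪ ω := by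
      intro x hx
      by_contra hc
      rw [mem_union, not_or] at hc
      have h1 : ψ n x = 0 := image_eq_zero_of_notMem_tsupport fun h => hc.1 ((hψ n).2.2 h)
      have h2 : φ x = 0 := image_eq_zero_of_notMem_tsupport fun h => hc.2 (hφ.2.2 h)
      exact hx.2 (by simp [h1, h2])
    have hm : mvol (Om D (ψ n + t • φ)) ≤ a := by
      refine le_trans ?_ hle
      refine ENNReal.toReal_mono ((measure_mono hOmD).trans_lt hDb.measure_lt_top).ne ?_
      calc volume (Om D (ψ n + t • φ)) ≤ volume (Om D u ∪ ω) := measure_mono hsub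
        _ = volume (Om D u ∪ (ω \ Om D u)) := by rw [union_sdiff_self]
        _ ≤ volume (Om D u) + volume (ω \ Om D u) := measure_union_le _ _
        _ = volume (Om D u) := by rw [null_diff hD hDb hcont hωD hfull, add_zero]
    refine (hmin _ tw.memH10 hm).trans_eq ?_
    unfold Jfun
    rw [grad_add_smul (hψ n).diff hφ.diff t]
    simp only [real_inner_self_eq_norm_sq, Real.norm_eq_abs, sq_abs]
  have := quad_zero (A := Jfun lam u)
    (B := (∫ x, ⟪gradient u x, gradient φ x⟫) - lam * ∫ x, ⟪u x, φ x⟫)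
    (C := (∫ x, ‖gradient φ x‖ ^ 2) - lam * ∫ x, ‖φ x‖ ^ 2) (by
      intro t
      refine (key t).trans_eq ?_
      rw [quad_int hug hφ.glp, quad_int hul hφ.lp]
      unfold Jfun
      simp only [Real.norm_eq_abs, sq_abs]
      ring)
  have e : ∫ x, u x * φ x = ∫ x, ⟪u x, φ x⟫ := by
    congr 1; ext x; simp [mul_comm]
  rw [e]; linarith


def etaF (y : Euc d) : ℝ := 2 * deriv expNegInvGlue (1 - ‖y‖ ^ 2)

lemma glue_deriv (x : ℝ) : deriv expNegInvGlue x = (x⁻¹) ^ 2 * expNegInvGlue x := by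
  have := expNegInvGlue.hasDerivAt_polynomial_eval_inv_mul 1 x
  simp only [Polynomial.eval_one, one_mul, Polynomial.derivative_one, sub_zero, mul_one,
    Polynomial.eval_pow, Polynomial.eval_X] at this
  exact this.deriv

lemma glue_hasDerivAt (x : ℝ) : HasDerivAt expNegInvGlue (deriv expNegInvGlue x) x :=
  ((expNegInvGlue.contDiff (n := 1)).differentiable (by simp) x).hasDerivAt

lemma etaF_cont : Continuous (etaF : Euc d → ℝ) := by
  have : Continuous (deriv expNegInvGlue) := (expNegInvGlue.contDiff (n := 1)).continuous_deriv le_rfl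
  unfold etaF
  fun_prop

lemma etaF_nonneg (y : Euc d) : 0 ≤ etaF y := by
  unfold etaF
  rw [glue_deriv]
  have := expNegInvGlue.nonneg (1 - ‖y‖ ^ 2)
  positivity

lemma etaF_pos {y : Euc d} (hy : ‖y‖ < 1) : 0 < etaF y := by
  have h : 0 < 1 - ‖y‖ ^ 2 := by nlinarith [norm_nonneg y]
  unfold etaF
  rw [glue_deriv]
  have := expNegInvGlue.pos_of_pos h
  positivity

lemma etaF_zero {y : Euc d} (hy : 1 ≤ ‖y‖) : etaF y = 0 := by
  have h : 1 - ‖y‖ ^ 2 ≤ 0 := by nlinarith [norm_nonneg y]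
  unfold etaF
  rw [glue_deriv, expNegInvGlue.zero_of_nonpos h]
  simp

lemma etaF_cs : HasCompactSupport (etaF : Euc d → ℝ) :=
  HasCompactSupport.of_support_subset_isCompact (isCompact_closedBall (0 : Euc d) 1) (by
    intro y hy
    by_contra h
    simp only [mem_closedBall, dist_zero_right, not_le] at h
    exact hy (etaF_zero h.le))

lemma etaF_lp : MemLp (etaF : Euc d → ℝ) 2 volume := etaF_cont.memLp_of_hasCompactSupport etaF_cs

lemma etaFv_cont : Continuous (fun y : Euc d => etaF y • y) := etaF_cont.smul continuous_id

lemma etaFv_cs : HasCompactSupport (fun y : Euc d => etaF y • y) :=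
  etaF_cs.smul_right (f' := fun y : Euc d => y)

lemma etaFv_lp : MemLp (fun y : Euc d => etaF y • y) 2 volume :=
  etaFv_cont.memLp_of_hasCompactSupport etaFv_cs

def phiT (x0 : Euc d) (t : ℝ) (x : Euc d) : ℝ := expNegInvGlue (1 - ‖t⁻¹ • (x - x0)‖ ^ 2)

lemma phiT_test {ω : Set (Euc d)} {x0 : Euc d} {t : ℝ} (ht : 0 < t) (hb : closedBall x0 t ⊆ ω) :
    TestFun ω (phiT x0 t) := by
  have hs : Function.support (phiT x0 t) ⊆ closedBall x0 t := by
    intro x hx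
    by_contra h
    simp only [mem_closedBall, not_le, dist_eq_norm] at h
    apply hx
    apply expNegInvGlue.zero_of_nonpos
    rw [norm_smul, norm_inv, Real.norm_eq_abs, abs_of_pos ht]
    have : 1 ≤ t⁻¹ * ‖x - x0‖ := by
      rw [inv_mul_eq_div, one_le_div ht]; exact h.le
    nlinarith
  refine ⟨?_, HasCompactSupport.of_support_subset_isCompact (isCompact_closedBall x0 t) hs,
    (closure_minimal hs isClosed_closedBall).trans hb⟩
  refine expNegInvGlue.contDiff.comp ?_
  refine contDiff_const.sub (ContDiff.norm_sq ℝ ?_)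
  exact (contDiff_const (c := t⁻¹)).smul (contDiff_id.sub (contDiff_const (c := x0)))

lemma phiT_nonneg (x0 : Euc d) (t : ℝ) (x : Euc d) : 0 ≤ phiT x0 t x := expNegInvGlue.nonneg _

lemma phiT_grad (x0 : Euc d) {t : ℝ} (ht : 0 < t) (y : Euc d) :
    gradient (phiT x0 t) (x0 + t • y) = -(t⁻¹ • etaF y • y) := by
  have h1 : HasFDerivAt (fun x : Euc d => t⁻¹ • (x - x0))
      (t⁻¹ • ContinuousLinearMap.id ℝ (Euc d)) (x0 + t • y) :=
    ((hasFDerivAt_id _).sub_const x0).const_smul t⁻¹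
  have e : t⁻¹ • (x0 + t • y - x0) = y := by
    rw [add_sub_cancel_left, smul_smul, inv_mul_cancel₀ ht.ne', one_smul]
  have h2 : HasFDerivAt (fun z : Euc d => ‖z‖ ^ 2) (2 • (innerSL ℝ) y) (t⁻¹ • (x0 + t • y - x0)) := by
    rw [e]; exact (hasStrictFDerivAt_norm_sq y).hasFDerivAt
  have h3 := (HasFDerivAt.comp (f := fun x : Euc d => t⁻¹ • (x - x0)) (x0 + t • y) h2 h1).const_sub 1
  have h4 := (glue_hasDerivAt (1 - ‖t⁻¹ • (x0 + t • y - x0)‖ ^ 2)).comp_hasFDerivAt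
    (f := fun x : Euc d => 1 - ‖t⁻¹ • (x - x0)‖ ^ 2) (x0 + t • y) h3
  have h5 : HasGradientAt (phiT x0 t) (-(t⁻¹ • etaF y • y)) (x0 + t • y) := by
    rw [hasGradientAt_iff_hasFDerivAt]
    refine HasFDerivAt.congr_fderiv h4 ?_
    ext v
    rw [e]
    simp [etaF]
    ring
  exact h5.gradient

lemma map_T (x0 : Euc d) {t : ℝ} (ht : 0 < t) :
    Measure.map (fun y : Euc d => x0 + t • y) volume = ENNReal.ofReal ((t ^ d)⁻¹) • volume := by
  have h := Measure.map_addHaar_smul (volume : Measure (Euc d)) ht.ne'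
  rw [abs_of_pos (by positivity)] at h
  have e : (fun y : Euc d => x0 + t • y) = (fun y => x0 + y) ∘ (fun y => t • y) := rfl
  rw [e, ← Measure.map_map (measurable_const_add x0) (measurable_const_smul t), h,
    Measure.map_smul, map_add_left_eq_self]
  simp

lemma emb_T (x0 : Euc d) {t : ℝ} (ht : 0 < t) :
    MeasurableEmbedding (fun y : Euc d => x0 + t • y) :=
  ((Homeomorph.smulOfNeZero t ht.ne').trans (Homeomorph.addLeft x0)).measurableEmbedding

lemma eLp_T {E' : Type*} [NormedAddCommGroup E'] (f : Euc d → E') (x0 : Euc d) {t : ℝ} (ht : 0 < t) :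
    eLpNorm (fun y => f (x0 + t • y)) 2 volume =
      ENNReal.ofReal ((t ^ d)⁻¹) ^ (1 / 2 : ℝ) * eLpNorm f 2 volume := by
  have := (emb_T x0 ht).eLpNorm_map_measure (μ := volume) (p := 2) (g := f)
  rw [map_T x0 ht, eLpNorm_smul_measure_of_ne_top (by simp)] at this
  simpa [Function.comp_def] using this.symm

lemma memLp_T {E' : Type*} [NormedAddCommGroup E'] {f : Euc d → E'} (hf : MemLp f 2 volume)
    (x0 : Euc d) {t : ℝ} (ht : 0 < t) : MemLp (fun y => f (x0 + t • y)) 2 volume := by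
  have := (emb_T x0 ht).memLp_map_measure_iff (μ := volume) (p := 2) (g := f)
  rw [map_T x0 ht] at this
  exact this.1 (hf.smul_measure (by simp))

lemma int_T (f : Euc d → ℝ) (x0 : Euc d) {t : ℝ} (ht : 0 < t) :
    ∫ y, f (x0 + t • y) = (t ^ d)⁻¹ * ∫ x, f x := by
  have := (emb_T x0 ht).integral_map (μ := volume) f
  rw [← this, map_T x0 ht, integral_smul_measure, ENNReal.toReal_ofReal (by positivity), smul_eq_mul]

lemma CS_le {E' : Type*} [NormedAddCommGroup E'] [InnerProductSpace ℝ E']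
    {f g : Euc d → E'} (hf : MemLp f 2 volume) (hg : MemLp g 2 volume) :
    ∫ x, ⟪f x, g x⟫ ≤ (eLpNorm f 2 volume).toReal * (eLpNorm g 2 volume).toReal := by
  rw [int_inner hf hg, ← Lp.norm_toLp f hf, ← Lp.norm_toLp g hg]
  exact real_inner_le_norm _ _

lemma int_able {E' : Type*} [NormedAddCommGroup E'] [InnerProductSpace ℝ E']
    {f g : Euc d → E'} (hf : MemLp f 2 volume) (hg : MemLp g 2 volume) :
    Integrable (fun x => ⟪f x, g x⟫) volume := by
  refine (L2.integrable_inner (𝕜 := ℝ) (hf.toLp f) (hg.toLp g)).congr ?_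
  filter_upwards [hf.coeFn_toLp, hg.coeFn_toLp] with x h1 h2
  rw [h1, h2]


def mavg (v : Euc d → ℝ) (x0 : Euc d) (t : ℝ) : ℝ := ∫ y, etaF y * v (x0 + t • y)

lemma mavg_inner (v : Euc d → ℝ) (x0 : Euc d) (t : ℝ) :
    mavg v x0 t = ∫ y, ⟪v (x0 + t • y), etaF y⟫ := rfl

lemma mavg_deriv {Ω : Set (Euc d)} {ψ : Euc d → ℝ} (hψ : TestFun Ω ψ) (x0 : Euc d) (t : ℝ) :
    HasDerivAt (mavg ψ x0) (∫ y, ⟪gradient ψ (x0 + t • y), etaF y • y⟫) t := by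
  obtain ⟨C, hC⟩ := hψ.sg.exists_bound_of_continuous hψ.cg
  have hcψ := hψ.1.continuous
  have hcη := etaF_cont (d := d)
  have hcg := hψ.cg
  refine (hasDerivAt_integral_of_dominated_loc_of_deriv_le (s := univ)
    (F := fun t y => etaF y * ψ (x0 + t • y))
    (F' := fun t y => ⟪gradient ψ (x0 + t • y), etaF y • y⟫)
    (bound := fun y => C * ‖etaF y • y‖) univ_mem ?_ ?_ ?_ ?_ ?_ ?_).2
  · exact Eventually.of_forall fun s => (by fun_prop : Continuous fun y : Euc d => etaF y * ψ (x0 + s • y)).aestronglyMeasurable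
  · exact (by fun_prop : Continuous fun y : Euc d => etaF y * ψ (x0 + t • y)).integrable_of_hasCompactSupport
      (etaF_cs.mul_right)
  · exact (by fun_prop : Continuous fun y : Euc d => ⟪gradient ψ (x0 + t • y), etaF y • y⟫).aestronglyMeasurable
  · refine ae_of_all _ fun y s _ => ?_
    refine (norm_inner_le_norm _ _).trans ?_
    gcongr
    exact hC _
  · exact ((etaFv_cont.integrable_of_hasCompactSupport etaFv_cs).norm).const_mul C
  · refine ae_of_all _ fun y s _ => ?_
    have h1 : HasDerivAt (fun s : ℝ => x0 + s • y) y s := by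
      simpa using ((hasDerivAt_id s).smul_const y).const_add x0
    have h2 := ((hψ.diff (x0 + s • y)).hasFDerivAt.comp_hasDerivAt s h1).const_mul (etaF y)
    refine h2.congr_deriv ?_
    rw [inner_smul_right, inner_gradient_left]

lemma mavg_step {D ω : Set (Euc d)} {u : Euc d → ℝ} (hH : MemH10 D u)
    (hsup : ∀ φ : Euc d → ℝ, TestFun ω φ → (∀ x, 0 ≤ φ x) → 0 ≤ ∫ x, ⟪gradient u x, gradient φ x⟫)
    {x0 : Euc d} {t1 t2 : ℝ} (h1 : 0 < t1) (h12 : t1 ≤ t2) (hb : closedBall x0 t2 ⊆ ω) :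
    mavg u x0 t2 ≤ mavg u x0 t1 := by
  obtain ⟨ψ, hψ, T1, T2⟩ := H10_seq hH
  have hug : MemLp (gradient u) 2 volume := hH.2.1
  have hul := hH.1
  have T1' : Tendsto (fun n => eLpNorm (ψ n - u) 2 volume) atTop (𝓝 0) := by
    simpa only [eLpNorm_sub_comm u] using T1
  have lim : ∀ t : ℝ, 0 < t → Tendsto (fun n => mavg (ψ n) x0 t) atTop (𝓝 (mavg u x0 t)) := by
    intro t ht
    refine L2_tendsto (F := fun n y => ψ n (x0 + t • y)) (G := fun _ => etaF)
      (f := fun y => u (x0 + t • y)) (g := etaF) (memLp_T hul x0 ht) etaF_lp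
      (fun n => memLp_T (hψ n).lp x0 ht) (fun _ => etaF_lp) ?_ (by simp)
    have e : ∀ n, eLpNorm ((fun y => ψ n (x0 + t • y)) - fun y => u (x0 + t • y)) 2 volume =
        ENNReal.ofReal ((t ^ d)⁻¹) ^ (1 / 2 : ℝ) * eLpNorm (ψ n - u) 2 volume :=
      fun n => eLp_T (ψ n - u) x0 ht
    simp only [e]
    have := ENNReal.Tendsto.const_mul (a := ENNReal.ofReal ((t ^ d)⁻¹) ^ (1 / 2 : ℝ)) T1'
      (Or.inr (by simp))
    simpa using this
  set N : ℝ := (eLpNorm (fun y : Euc d => etaF y • y) 2 volume).toReal with hN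
  set c : ℝ := (ENNReal.ofReal ((t1 ^ d)⁻¹) ^ (1 / 2 : ℝ)).toReal with hc
  set ε : ℕ → ℝ := fun n => (eLpNorm (gradient u - gradient (ψ n)) 2 volume).toReal with hε
  have hεl : Tendsto ε atTop (𝓝 0) := by
    have := (ENNReal.tendsto_toReal ENNReal.zero_ne_top).comp T2
    simpa [Function.comp_def, hε] using this
  have dle : ∀ n, ∀ t, t1 ≤ t → t ≤ t2 →
      ∫ y, ⟪gradient (ψ n) (x0 + t • y), etaF y • y⟫ ≤ c * ε n * N := by
    intro n t ht1 ht2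
    have ht : 0 < t := h1.trans_le ht1
    have m1 := memLp_T hug x0 ht
    have hdm : MemLp (gradient (ψ n) - gradient u) 2 volume := (hψ n).glp.sub hug
    have m2 := memLp_T hdm x0 ht
    have split : ∫ y, ⟪gradient (ψ n) (x0 + t • y), etaF y • y⟫ =
        (∫ y, ⟪gradient u (x0 + t • y), etaF y • y⟫) +
        ∫ y, ⟪(gradient (ψ n) - gradient u) (x0 + t • y), etaF y • y⟫ := by
      rw [← integral_add (int_able m1 etaFv_lp) (int_able m2 etaFv_lp)]
      congr 1; ext y
      rw [← inner_add_left]; simp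
    have neg : ∫ y, ⟪gradient u (x0 + t • y), etaF y • y⟫ ≤ 0 := by
      have e : ∀ y : Euc d, ⟪gradient u (x0 + t • y), etaF y • y⟫ =
          (fun x => -t * ⟪gradient u x, gradient (phiT x0 t) x⟫) (x0 + t • y) := by
        intro y
        simp only
        rw [phiT_grad x0 ht, inner_neg_right, inner_smul_right _ _ t⁻¹]
        field_simp
      simp only [e]
      rw [int_T (fun x => -t * ⟪gradient u x, gradient (phiT x0 t) x⟫) x0 ht, integral_const_mul]
      have p := hsup (phiT x0 t) (phiT_test ht ((closedBall_subset_closedBall ht2).trans hb))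
        (phiT_nonneg x0 t)
      have q : 0 ≤ (t ^ d)⁻¹ * (t * ∫ x, ⟪gradient u x, gradient (phiT x0 t) x⟫) := by positivity
      linarith
    have cs := CS_le m2 etaFv_lp
    have b : (eLpNorm (fun y => (gradient (ψ n) - gradient u) (x0 + t • y)) 2 volume).toReal ≤
        c * ε n := by
      rw [eLp_T _ x0 ht, ENNReal.toReal_mul, eLpNorm_sub_comm]
      refine mul_le_mul_of_nonneg_right ?_ ENNReal.toReal_nonneg
      refine ENNReal.toReal_mono (by simp) ?_
      gcongr
    rw [split]
    have := mul_le_mul_of_nonneg_right b (ENNReal.toReal_nonneg : 0 ≤ N)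
    linarith
  have fin : ∀ n, mavg (ψ n) x0 t2 - mavg (ψ n) x0 t1 ≤ c * ε n * N * (t2 - t1) := by
    intro n
    refine Convex.image_sub_le_mul_sub_of_deriv_le (convex_Icc t1 t2)
      (fun t _ => (mavg_deriv (hψ n) x0 t).continuousAt.continuousWithinAt)
      (fun t _ => (mavg_deriv (hψ n) x0 t).differentiableAt.differentiableWithinAt) ?_
      t1 (left_mem_Icc.2 h12) t2 (right_mem_Icc.2 h12) h12
    intro t ht
    have ht' := interior_subset ht
    rw [(mavg_deriv (hψ n) x0 t).deriv]
    exact dle n t ht'.1 ht'.2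
  have r : Tendsto (fun n => c * ε n * N * (t2 - t1)) atTop (𝓝 0) := by
    simpa using ((hεl.const_mul c).mul_const N).mul_const (t2 - t1)
  have := le_of_tendsto_of_tendsto' ((lim t2 (h1.trans_le h12)).sub (lim t1 h1)) r fin
  linarith

lemma claim2 {D ω : Set (Euc d)} {u : Euc d → ℝ} (hH : MemH10 D u)
    (hD : IsOpen D) (hcont : ContinuousOn u D) (hnn : ∀ x ∈ D, 0 ≤ u x)
    (hω : IsOpen ω) (hωD : ω ⊆ D) (hnull : volume (ω \ Om D u) = 0)
    (hsup : ∀ φ : Euc d → ℝ, TestFun ω φ → (∀ x, 0 ≤ φ x) → 0 ≤ ∫ x, ⟪gradient u x, gradient φ x⟫)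
    {x0 : Euc d} (hx0 : x0 ∈ ω) : 0 < u x0 := by
  rcases (hnn x0 (hωD hx0)).lt_or_eq with h | h
  · exact h
  exfalso
  obtain ⟨R, hR, hRb⟩ := Metric.nhds_basis_closedBall.mem_iff.1 (hω.mem_nhds hx0)
  have inb : ∀ t : ℝ, 0 < t → ∀ y : Euc d, ‖y‖ < 1 → dist (x0 + t • y) x0 < t := by
    intro t ht y hy
    rw [dist_eq_norm, add_sub_cancel_left, norm_smul, Real.norm_eq_abs, abs_of_pos ht]
    nlinarith
  have intb : ∀ t : ℝ, 0 < t → Integrable (fun y => etaF y * u (x0 + t • y)) volume := by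
    intro t ht
    have := int_able (memLp_T hH.1 x0 ht) (etaF_lp (d := d))
    exact this
  have pos : 0 < mavg u x0 R := by
    have nn : 0 ≤ fun y : Euc d => etaF y * u (x0 + R • y) := by
      intro y
      by_cases hy : ‖y‖ < 1
      · exact mul_nonneg (etaF_nonneg y) (hnn _ (hωD (hRb (inb R hR y hy).le)))
      · simp [etaF_zero (not_lt.1 hy)]
    refine (integral_pos_iff_support_of_nonneg nn (intb R hR)).2 ?_
    have z : volume ((fun y : Euc d => x0 + R • y) ⁻¹' (ω \ Om D u)) = 0 := by
      rw [← (emb_T x0 hR).map_apply, map_T x0 hR]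
      simp [hnull]
    have sub : ball (0 : Euc d) 1 \ ((fun y : Euc d => x0 + R • y) ⁻¹' (ω \ Om D u)) ⊆
        Function.support fun y : Euc d => etaF y * u (x0 + R • y) := by
      rintro y ⟨hy, hy2⟩
      rw [mem_ball_zero_iff] at hy
      have hin : x0 + R • y ∈ ω := hRb (inb R hR y hy).le
      have : x0 + R • y ∈ Om D u := by
        by_contra hc
        exact hy2 ⟨hin, hc⟩
      exact mul_ne_zero (etaF_pos hy).ne' this.2
    refine lt_of_lt_of_le ?_ (measure_mono sub)
    rw [measure_sdiff_null z]
    exact measure_ball_pos _ _ one_pos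
  set I : ℝ := ∫ y : Euc d, etaF y with hI
  have hI0 : 0 ≤ I := integral_nonneg etaF_nonneg
  have small : ∀ e > 0, mavg u x0 R ≤ e * I := by
    intro e he
    have hc : ContinuousAt u x0 := hcont.continuousAt (hD.mem_nhds (hωD hx0))
    obtain ⟨δ, hδ, hδb⟩ := Metric.continuousAt_iff.1 hc e he
    have ht : 0 < min δ R := lt_min hδ hR
    refine (mavg_step hH hsup ht (min_le_right δ R) hRb).trans ?_
    rw [hI, ← integral_const_mul]
    refine integral_mono (intb _ ht)
      ((etaF_cont.integrable_of_hasCompactSupport etaF_cs).const_mul e) fun y => ?_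
    by_cases hy : ‖y‖ < 1
    · have := hδb ((inb _ ht y hy).trans_le (min_le_left _ _))
      rw [← h, Real.dist_eq, sub_zero] at this
      have h2 := (le_abs_self _).trans this.le
      simp only
      rw [mul_comm]
      exact mul_le_mul_of_nonneg_right h2 (etaF_nonneg y)
    · simp [etaF_zero (not_lt.1 hy)]
  have := small (mavg u x0 R / (2 * (I + 1))) (by positivity)
  have e2 : mavg u x0 R / (2 * (I + 1)) * I < mavg u x0 R := by
    rw [div_mul_eq_mul_div, div_lt_iff₀ (by positivity)]
    nlinarith
  linarith

lemma lamOpt_nonneg (D : Set (Euc d)) (a : ℝ) : 0 ≤ lamOpt D a := by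
  refine Real.sInf_nonneg ?_
  rintro t ⟨Ω, -, -, -, rfl⟩
  refine Real.sInf_nonneg ?_
  rintro t ⟨v, -, -, rfl⟩
  exact integral_nonneg fun x => by positivity

/-- If `ω ⊆ D` is open with `|Ω_u ∩ ω| = |ω|`, then `-Δu = λ_a u` in `ω` in
the sense of distributions, and consequently `u > 0` everywhere in `ω` (so `ω ⊆ Ω_u`). -/
theorem full_measure_implies_eigen_equation
    {d : ℕ} (D ω : Set (Euc d)) (a lama : ℝ) (u : Euc d → ℝ)
    (hD : IsOpen D) (hDb : Bornology.IsBounded D)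
    (ha : 0 < a) (ha' : a < mvol D)
    (hlam : lama = lamOpt D a) (hu : IsJMinimizer D a lama u)
    (hcont : ContinuousOn u D) (hnn : ∀ x ∈ D, 0 ≤ u x)
    (hω : IsOpen ω) (hωD : ω ⊆ D) (hfull : mvol (Om D u ∩ ω) = mvol ω) :
    (∀ φ : Euc d → ℝ, TestFun ω φ →
      (∫ x, ⟪gradient u x, gradient φ x⟫) = lama * ∫ x, u x * φ x) ∧
    ∀ x ∈ ω, 0 < u x := by
  have h1 : ∀ φ : Euc d → ℝ, TestFun ω φ →
      (∫ x, ⟪gradient u x, gradient φ x⟫) = lama * ∫ x, u x * φ x := fun φ hφ =>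
    claim1 hD hDb hu hcont hnn hωD hfull hφ
  refine ⟨h1, fun x hx => claim2 hu.1 hD hcont hnn hω hωD
    (null_diff hD hDb hcont hωD hfull) (fun φ hφ hpos => ?_) hx⟩
  rw [h1 φ hφ]
  refine mul_nonneg (hlam ▸ lamOpt_nonneg D a) (integral_nonneg fun y => ?_)
  by_cases hy : y ∈ ω
  · exact mul_nonneg (hnn y (hωD hy)) (hpos y)
  · have : φ y = 0 := image_eq_zero_of_notMem_tsupport fun h => hy (hφ.2.2 h)
    simp [this]

end
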